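/- Suppose d ≥ 3 is odd and let Φ ∈ 𝒮(ℂ^d). Then there is a unique function f : ℂ∖{0} → ℂ, smooth as a function of the two real coordinates, such that ∫_{ℂ^d} g(q_d(z)) Φ(z) dz = ∫_ℂ g(ξ) f(ξ) dξ for every continuous compactly supported g : ℂ → ℂ whose support does not contain 0. Moreover there exist functions C₀, C₁ : ℂ → ℂ, smooth as functions of the two real coordinates, such that f(ξ) = C₀(ξ) + C₁(ξ)·|ξ|^{d−2} for all ξ ≠ 0. -/

import Mathlib

open MeasureTheory Filter

noncomputable section

/-- Extension of a vector in `ℂ^d` by zeros, for convenient indexing. -/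
def padC {d : ℕ} (z : Fin d → ℂ) (n : ℕ) : ℂ :=
  if h : n < d then z ⟨n, h⟩ else 0

/-- The split quadratic form `q_d` on `ℂ^d`. -/
def splitQC (d : ℕ) (z : Fin d → ℂ) : ℂ :=
  if Even d then ∑ i ∈ Finset.range (d / 2), padC z (2 * i) * padC z (2 * i + 1)
  else padC z 0 ^ 2 + ∑ i ∈ Finset.range (d / 2), padC z (2 * i + 1) * padC z (2 * i + 2)

/-- scaling bound: for `G` compactly supported of class `C^n`, all derivatives of order `k < n` of
`L^{-n} G(L ·)` are small for `L` large. -/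
lemma borel_scale (n : ℕ) (G : ℂ → ℂ) (hG : ContDiff ℝ n G) (hc : HasCompactSupport G) (m : ℕ)
    (hm : n ≤ m) (ε : ℝ) (hε : 0 < ε) :
    ∀ᶠ L : ℝ in atTop, ∀ k < n, ∀ x : ℂ,
      ‖iteratedFDeriv ℝ k (fun x : ℂ => ((L⁻¹ ^ m : ℝ) : ℂ) * G (L • x)) x‖ ≤ ε := by
  have key : ∀ k < n, ∀ᶠ L : ℝ in atTop, ∀ x : ℂ,
      ‖iteratedFDeriv ℝ k (fun x : ℂ => ((L⁻¹ ^ m : ℝ) : ℂ) * G (L • x)) x‖ ≤ ε := by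
    intro k hk
    have hkn : ((k : ℕ∞) : WithTop ℕ∞) ≤ n := by exact_mod_cast hk.le
    have hcont := hG.continuous_iteratedFDeriv hkn
    obtain ⟨B, hB⟩ := (hc.iteratedFDeriv (𝕜 := ℝ) k).exists_bound_of_continuous hcont
    have hB0 : 0 ≤ B := (norm_nonneg _).trans (hB 0)
    filter_upwards [eventually_ge_atTop 1, eventually_ge_atTop (B / ε)] with L hL1 hL2 x
    have hL0 : 0 < L := by linarith
    have hGk : ContDiff ℝ k G := hG.of_le hkn
    have e1 : (fun x : ℂ => ((L⁻¹ ^ m : ℝ) : ℂ) * G (L • x))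
        = (L⁻¹ ^ m : ℝ) • (fun x : ℂ => G (L • x)) := by
      ext x; simp [Pi.smul_apply]
    have hGL : ContDiff ℝ k (fun x : ℂ => G (L • x)) := hGk.comp (contDiff_const_smul L)
    rw [e1, iteratedFDeriv_const_smul_apply hGL.contDiffAt, iteratedFDeriv_comp_const_smul L hGk]
    simp only [norm_smul, norm_pow, norm_inv, Real.norm_of_nonneg hL0.le]
    have h3 : L⁻¹ ^ m * L ^ k ≤ L⁻¹ := by
      have : L⁻¹ ^ m ≤ L⁻¹ ^ (k+1) :=
        pow_le_pow_of_le_one (by positivity) (inv_le_one_of_one_le₀ hL1) (by omega)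
      calc L⁻¹ ^ m * L ^ k ≤ L⁻¹ ^ (k+1) * L ^ k := by gcongr
        _ = L⁻¹ := by rw [pow_succ, inv_pow]; field_simp
    calc L⁻¹ ^ m * (L ^ k * ‖iteratedFDeriv ℝ k G (L • x)‖)
        = (L⁻¹ ^ m * L ^ k) * ‖iteratedFDeriv ℝ k G (L • x)‖ := by ring
      _ ≤ L⁻¹ * B := by gcongr; exact hB _
      _ ≤ ε := by
        rw [div_le_iff₀ hε] at hL2
        rw [inv_mul_le_iff₀ hL0]; linarith
  have := (Finset.range n).eventually_all.2 (fun k hk => key k (Finset.mem_range.1 hk))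
  filter_upwards [this] with L hL k hk x using hL k (Finset.mem_range.2 hk) x

lemma smooth_norm_mul (κ : ℕ) (A : ℂ → ℂ) (N : ℕ) (hA : ContDiff ℝ N A)
    (h0 : A =ᶠ[nhds 0] 0) : ContDiff ℝ N (fun x : ℂ => ((‖x‖ ^ κ : ℝ) : ℂ) * A x) := by
  rw [contDiff_iff_contDiffAt]
  intro x
  by_cases hx : x = 0
  · subst hx
    have : (fun x : ℂ => ((‖x‖ ^ κ : ℝ) : ℂ) * A x) =ᶠ[nhds 0] fun _ => 0 := by
      filter_upwards [h0] with y hy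
      simp [hy]
    exact contDiffAt_const.congr_of_eventuallyEq this
  · have h1 : ContDiffAt ℝ N (fun x : ℂ => ‖x‖ ^ κ) x := (contDiffAt_norm ℝ hx).pow κ
    have h2 : ContDiffAt ℝ N (fun x : ℂ => ((‖x‖ ^ κ : ℝ) : ℂ)) x :=
      Complex.ofRealCLM.contDiff.contDiffAt.comp x h1
    exact h2.mul hA.contDiffAt

theorem borel_sum (κ : ℕ) (P : ℕ → ℂ → ℂ) (hP : ∀ n (N : ℕ), ContDiff ℝ N (P n))
    (hhom : ∀ n (L : ℝ) x, P n (L • x) = ((L ^ n : ℝ) : ℂ) * P n x)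
    (hsm : ∀ n : ℕ, ContDiff ℝ n (fun x : ℂ => ((‖x‖ ^ κ : ℝ) : ℂ) * P n x)) :
    ∃ C : ℂ → ℂ, (∀ N : ℕ, ContDiff ℝ N C) ∧
      ∀ N : ℕ, ContDiff ℝ N (fun x : ℂ => ((‖x‖ ^ κ : ℝ) : ℂ) *
        (C x - ∑ n ∈ Finset.range N, P n x)) := by
  let χ : ContDiffBump (0 : ℂ) := ⟨1, 2, by norm_num, by norm_num⟩
  have hχ : ∀ N : ℕ, ContDiff ℝ N (fun x : ℂ => ((χ x : ℝ) : ℂ)) := fun N =>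
    Complex.ofRealCLM.contDiff.comp χ.contDiff
  have hχc : HasCompactSupport (fun x : ℂ => ((χ x : ℝ) : ℂ)) :=
    χ.hasCompactSupport.comp_left (g := fun r : ℝ => (r : ℂ)) (by simp)
  have hev : ∀ n : ℕ, ∃ L : ℝ, 1 ≤ L ∧
      (∀ k < n, ∀ x : ℂ, ‖iteratedFDeriv ℝ k
        (fun x : ℂ => ((L⁻¹ ^ n : ℝ) : ℂ) * (P n (L • x) * χ (L • x))) x‖ ≤ (1/2:ℝ)^n) ∧
      (∀ k < n, ∀ x : ℂ, ‖iteratedFDeriv ℝ k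
        (fun x : ℂ => ((L⁻¹ ^ (n + κ) : ℝ) : ℂ) *
          ((((‖L • x‖ ^ κ : ℝ) : ℂ) * P n (L • x)) * χ (L • x))) x‖ ≤ (1/2:ℝ)^n) := by
    intro n
    have h1 := borel_scale n (fun x => P n x * χ x) ((hP n n).mul (hχ n)) hχc.mul_left n le_rfl
      ((1/2:ℝ)^n) (by positivity)
    have h2 := borel_scale n (fun x => (((‖x‖ ^ κ : ℝ) : ℂ) * P n x) * χ x)
      ((hsm n).mul (hχ n)) hχc.mul_left (n + κ) (by omega)
      ((1/2:ℝ)^n) (by positivity)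
    obtain ⟨L, hL⟩ := (h1.and (h2.and (eventually_ge_atTop 1))).exists
    exact ⟨L, hL.2.2, hL.1, hL.2.1⟩
  choose L hL1 hLa hLb using hev
  have hL0 : ∀ n, 0 < L n := fun n => by linarith [hL1 n]
  let E : ℕ → ℂ → ℂ := fun n x => P n x * χ (L n • x)
  have hEa : ∀ n, (fun x : ℂ => (((L n)⁻¹ ^ n : ℝ) : ℂ) * (P n (L n • x) * χ (L n • x))) = E n := by
    intro n; ext x
    have : (L n : ℂ) ≠ 0 := by exact_mod_cast (hL0 n).ne'
    simp only [E, hhom]; push_cast; rw [inv_pow]; field_simp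
  have hEb : ∀ n, (fun x : ℂ => (((L n)⁻¹ ^ (n + κ) : ℝ) : ℂ) *
          ((((‖L n • x‖ ^ κ : ℝ) : ℂ) * P n (L n • x)) * χ (L n • x)))
      = fun x => ((‖x‖ ^ κ : ℝ) : ℂ) * E n x := by
    intro n; ext x
    have : (L n : ℂ) ≠ 0 := by exact_mod_cast (hL0 n).ne'
    simp only [E, hhom, norm_smul, Real.norm_of_nonneg (hL0 n).le]; push_cast
    rw [inv_pow, mul_pow, pow_add]; field_simp
  simp only [hEa] at hLa
  simp only [hEb] at hLb
  have hχL : ∀ n N : ℕ, ContDiff ℝ N (fun x : ℂ => ((χ (L n • x) : ℝ) : ℂ)) := fun n N =>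
    (hχ N).comp (contDiff_const_smul (L n))
  have hE : ∀ n (N : ℕ), ContDiff ℝ N (E n) := fun n N => (hP n N).mul (hχL n N)
  have hgeo : Summable (fun n : ℕ => (1/2:ℝ)^n) := summable_geometric_two
  have hsum : ∀ x, Summable (fun n => E n x) := by
    intro x
    refine Summable.of_norm_bounded_eventually_nat hgeo ?_
    filter_upwards [eventually_gt_atTop 0] with n hn
    simpa using hLa n 0 hn x
  refine ⟨fun x => ∑' n, E n x, ?_, ?_⟩
  · intro N
    refine contDiff_tsum_of_eventually (N := N) (v := fun _ n => (1/2:ℝ)^n) (fun n => hE n N)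
      (fun k _ => hgeo) ?_
    intro k hk
    rw [Nat.cofinite_eq_atTop]
    filter_upwards [eventually_gt_atTop k] with n hn x using hLa n k hn x
  · intro N
    have h1 : ∀ x : ℂ, ((‖x‖ ^ κ : ℝ) : ℂ) * (∑' n, E n x - ∑ n ∈ Finset.range N, P n x)
      = (∑ n ∈ Finset.range N, ((‖x‖ ^ κ : ℝ) : ℂ) * (P n x * (χ (L n • x) - 1)))
        + ∑' n, (if n < N then 0 else ((‖x‖ ^ κ : ℝ) : ℂ) * E n x) := by
      intro x
      have hs2 : Summable (fun n => (if n < N then 0 else ((‖x‖ ^ κ : ℝ) : ℂ) * E n x)) := by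
        refine ((hsum x).mul_left ((‖x‖ ^ κ : ℝ) : ℂ)).congr_cofinite ?_
        rw [Nat.cofinite_eq_atTop]
        filter_upwards [eventually_ge_atTop N] with n hn
        simp [not_lt.2 hn]
      rw [← (hsum x).sum_add_tsum_nat_add N, ← hs2.sum_add_tsum_nat_add N]
      rw [Finset.sum_eq_zero (s := Finset.range N)
        (f := fun n => (if n < N then 0 else ((‖x‖ ^ κ : ℝ) : ℂ) * E n x))]
      · simp only [add_lt_iff_neg_right, not_lt_zero, if_false, tsum_mul_left]
        simp only [← Finset.mul_sum, E, mul_sub, Finset.sum_sub_distrib, mul_one]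
        ring
      · intro n hn; simp [Finset.mem_range.1 hn]
    simp_rw [h1]
    refine ContDiff.add (ContDiff.sum fun n _ => ?_) ?_
    · refine smooth_norm_mul κ _ N ((hP n N).mul ((hχL n N).sub contDiff_const)) ?_
      have : ∀ᶠ x : ℂ in nhds 0, ‖L n • x‖ < 1 := by
        have : Continuous fun x : ℂ => ‖L n • x‖ := by fun_prop
        exact this.continuousAt.eventually_lt continuousAt_const (by simp)
      filter_upwards [this] with x hx
      have : χ (L n • x) = 1 := χ.one_of_mem_closedBall (by simpa [χ] using hx.le)
      simp only [this]; simp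
    · refine contDiff_tsum_of_eventually (N := N) (v := fun _ n => (1/2:ℝ)^n) (fun n => ?_)
        (fun k _ => hgeo) ?_
      · by_cases hn : n < N
        · simp only [hn, if_true]; exact contDiff_const
        · simp only [hn, if_false, E]
          have := ((hsm n).of_le (m := N) (by exact_mod_cast not_lt.1 hn)).mul (hχL n N)
          simp only [mul_assoc] at this
          exact this
      · intro k hk
        rw [Nat.cofinite_eq_atTop]
        filter_upwards [eventually_gt_atTop k, eventually_ge_atTop N] with n hn hn2 x
        simpa only [not_lt.2 hn2, if_false] using hLb n k hn x

def Qfun (j : ℕ) (x : ℝ) : ℝ := ∫ w in (0:ℝ)..1, w ^ (2 * j) * Real.exp (-x * w ^ 2)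

lemma Qfun_hasDerivAt (j : ℕ) (x : ℝ) : HasDerivAt (Qfun j) (- Qfun (j+1) x) x := by
  have h := intervalIntegral.hasDerivAt_integral_of_dominated_loc_of_deriv_le (μ := volume)
    (F := fun x w => w ^ (2 * j) * Real.exp (-x * w ^ 2))
    (F' := fun x w => - (w ^ (2 * (j + 1)) * Real.exp (-x * w ^ 2))) (x₀ := x)
    (a := 0) (b := 1) (s := Metric.ball x 1)
    (bound := fun _ => Real.exp (|x| + 1)) (Metric.ball_mem_nhds x one_pos)
    (Eventually.of_forall fun y => by
      refine Continuous.aestronglyMeasurable ?_; fun_prop)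
    (by refine Continuous.intervalIntegrable ?_ _ _; fun_prop)
    (by refine Continuous.aestronglyMeasurable ?_; fun_prop)
    (by
      refine Eventually.of_forall fun t ht y hy => ?_
      rw [Set.uIoc_of_le zero_le_one] at ht
      have h1 : t ^ (2 * (j+1)) ≤ 1 := pow_le_one₀ ht.1.le ht.2
      have h1' : t ^ 2 ≤ 1 := pow_le_one₀ ht.1.le ht.2
      have h0' : 0 ≤ t ^ 2 := by positivity
      have hy' : |y - x| < 1 := by simpa [Real.dist_eq] using hy
      have hyx : |y| ≤ |x| + 1 := by
        have := abs_add_le (y - x) x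
        simp only [sub_add_cancel] at this; linarith
      have h2 : -y * t ^ 2 ≤ |x| + 1 := by
        calc -y * t^2 ≤ |y| * t^2 := by gcongr; exact neg_le_abs y
          _ ≤ (|x| + 1) * 1 := by gcongr
          _ = _ := by ring
      rw [norm_neg, Real.norm_eq_abs, abs_mul, abs_of_nonneg (by have := ht.1; positivity),
        abs_of_pos (Real.exp_pos _)]
      calc t ^ (2 * (j+1)) * Real.exp (-y * t ^ 2) ≤ 1 * Real.exp (|x| + 1) := by gcongr
        _ = _ := one_mul _)
    (by simp)
    (by
      refine Eventually.of_forall fun t ht y hy => ?_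
      have : HasDerivAt (fun x : ℝ => -x * t ^ 2) (-1 * t ^ 2) y :=
        ((hasDerivAt_id y).neg).mul_const _
      refine HasDerivAt.congr_deriv ((this.exp).const_mul (t ^ (2 * j))) ?_
      ring)
  have h2 := h.2
  rw [intervalIntegral.integral_neg] at h2
  exact h2

lemma Qfun_contDiff (N : ℕ) : ∀ j, ContDiff ℝ N (Qfun j) := by
  induction N with
  | zero =>
    intro j
    exact contDiff_zero.2 (continuous_iff_continuousAt.2 fun x =>
      (Qfun_hasDerivAt j x).continuousAt)
  | succ N ih =>
    intro j
    have hd : deriv (Qfun j) = fun x => - Qfun (j+1) x := by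
      ext x; exact (Qfun_hasDerivAt j x).deriv
    have : ((N + 1 : ℕ) : WithTop ℕ∞) = (N : WithTop ℕ∞) + 1 := by push_cast; rfl
    rw [this, contDiff_succ_iff_deriv]
    refine ⟨fun x => (Qfun_hasDerivAt j x).differentiableAt, by simp, ?_⟩
    rw [hd]; exact (ih (j+1)).neg

def Jfun (i : ℕ) (r : ℝ) : ℝ := ∫ v in (0:ℝ)..1, v ^ (2 * i) * Real.exp (-Real.pi * r ^ 2 / v ^ 2)

lemma J_integrable (i : ℕ) (r : ℝ) : IntervalIntegrable
    (fun v : ℝ => v ^ (2 * i) * Real.exp (-Real.pi * r ^ 2 / v ^ 2)) volume 0 1 := by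
  rw [intervalIntegrable_iff]
  refine Measure.integrableOn_of_bounded (M := 1) (by simp) ?_ ?_
  · refine Measurable.aestronglyMeasurable ?_
    fun_prop
  · rw [ae_restrict_iff' measurableSet_uIoc]
    refine Eventually.of_forall fun v hv => ?_
    rw [Set.uIoc_of_le zero_le_one] at hv
    have h1 : v ^ (2 * i) ≤ 1 := pow_le_one₀ hv.1.le hv.2
    rw [norm_mul, Real.norm_of_nonneg (Real.exp_pos _).le, Real.norm_of_nonneg (by have := hv.1; positivity)]
    have h2 : Real.exp (-Real.pi * r ^ 2 / v ^ 2) ≤ 1 := by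
      rw [Real.exp_le_one_iff, neg_mul, neg_div, neg_nonpos]
      have := Real.pi_pos; positivity
    exact mul_le_one₀ h1 (Real.exp_pos _).le h2

lemma exp_inv_deriv (r v : ℝ) (hv : v ≠ 0) :
    HasDerivAt (fun v : ℝ => Real.exp (-Real.pi * r ^ 2 / v ^ 2))
      (2 * Real.pi * r ^ 2 / v ^ 3 * Real.exp (-Real.pi * r ^ 2 / v ^ 2)) v := by
  have h1 : HasDerivAt (fun v : ℝ => -Real.pi * r ^ 2 / v ^ 2) (2 * Real.pi * r ^ 2 / v ^ 3) v := by
    have := (hasDerivAt_const v (-Real.pi * r ^ 2)).div (hasDerivAt_pow 2 v) (pow_ne_zero 2 hv)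
    refine HasDerivAt.congr_deriv this ?_
    field_simp
    simp
    ring
  refine HasDerivAt.congr_deriv h1.exp ?_
  ring

lemma exp_inv_le_one (r v : ℝ) : Real.exp (-Real.pi * r ^ 2 / v ^ 2) ≤ 1 := by
  rw [Real.exp_le_one_iff, neg_mul, neg_div, neg_nonpos]
  have := Real.pi_pos; positivity

lemma pow_mul_exp_inv_tendsto (n : ℕ) (r : ℝ) (hn : n ≠ 0) :
    Tendsto (fun v : ℝ => v ^ n * Real.exp (-Real.pi * r ^ 2 / v ^ 2)) (nhdsWithin 0 (Set.Ioi 0))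
      (nhds 0) := by
  have h : Tendsto (fun v : ℝ => v ^ n) (nhdsWithin 0 (Set.Ioi 0)) (nhds 0) := by
    have : Tendsto (fun v : ℝ => v ^ n) (nhds 0) (nhds (0 ^ n)) := (continuous_pow n).tendsto 0
    rw [zero_pow hn] at this
    exact this.mono_left nhdsWithin_le_nhds
  refine squeeze_zero' ?_ ?_ h
  · filter_upwards [self_mem_nhdsWithin] with v hv
    have : (0:ℝ) < v := hv
    positivity
  · filter_upwards [self_mem_nhdsWithin] with v hv
    have : (0:ℝ) < v := hv
    exact mul_le_of_le_one_right (by positivity) (exp_inv_le_one r v)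

lemma J_zero (r : ℝ) (hr : 0 ≤ r) : Jfun 0 r =
    -Real.pi * r ^ 1 + (Real.exp (-Real.pi * r ^ 2) + 2 * Real.pi * r ^ 2 * Qfun 0 (Real.pi * r ^ 2)) := by
  rcases hr.eq_or_lt with rfl | hr
  · simp [Jfun]
  have hpi := Real.pi_pos
  let g : ℝ → ℝ := fun y => ∫ w in (0:ℝ)..y, Real.exp (-(Real.pi * r ^ 2) * w ^ 2)
  have hg : ∀ y, HasDerivAt g (Real.exp (-(Real.pi * r ^ 2) * y ^ 2)) y := by
    intro y
    exact intervalIntegral.integral_hasDerivAt_right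
      (by refine Continuous.intervalIntegrable ?_ _ _; fun_prop)
      (Continuous.stronglyMeasurableAtFilter (by fun_prop) _ _)
      (by fun_prop)
  have hgl : Tendsto g atTop (nhds (1 / (2 * r))) := by
    have hi : IntegrableOn (fun w : ℝ => Real.exp (-(Real.pi * r ^ 2) * w ^ 2)) (Set.Ioi 0) :=
      (integrable_exp_neg_mul_sq (by positivity)).integrableOn
    have := intervalIntegral_tendsto_integral_Ioi 0 hi tendsto_id
    rw [integral_gaussian_Ioi] at this
    have e : √(Real.pi / (Real.pi * r ^ 2)) / 2 = 1 / (2 * r) := by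
      have : Real.pi / (Real.pi * r ^ 2) = (1 / r) ^ 2 := by field_simp
      rw [this, Real.sqrt_sq (by positivity)]; field_simp
    rw [e] at this
    exact this
  have key := intervalIntegral.integral_eq_sub_of_hasDerivAt_of_tendsto (a := 0) (b := 1)
    (f := fun v => v * Real.exp (-Real.pi * r ^ 2 / v ^ 2) + 2 * Real.pi * r ^ 2 * g (v⁻¹))
    (f' := fun v => v ^ (2 * 0) * Real.exp (-Real.pi * r ^ 2 / v ^ 2))
    (fa := 0 + 2 * Real.pi * r ^ 2 * (1 / (2 * r)))
    (fb := 1 * Real.exp (-Real.pi * r ^ 2 / 1 ^ 2) + 2 * Real.pi * r ^ 2 * g (1⁻¹))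
    one_pos ?_ (J_integrable 0 r) ?_ ?_
  · unfold Jfun
    rw [key]
    simp only [Qfun, g]
    norm_num
    have : 2 * Real.pi * r ^ 2 * (r⁻¹ * (1/2)) = Real.pi * r := by field_simp
    rw [this]
    ring
  · intro v hv
    have hv0 : v ≠ 0 := hv.1.ne'
    have h1 := (hasDerivAt_id v).mul (exp_inv_deriv r v hv0)
    have h2 := ((hg v⁻¹).comp v (hasDerivAt_inv hv0)).const_mul (2 * Real.pi * r ^ 2)
    refine HasDerivAt.congr_deriv (h1.add h2) ?_
    have : -(Real.pi * r ^ 2) * v⁻¹ ^ 2 = -Real.pi * r ^ 2 / v ^ 2 := by field_simp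
    rw [this]
    simp only [id]
    field_simp
    ring
  · refine Tendsto.add ?_ ((hgl.comp tendsto_inv_nhdsGT_zero).const_mul _)
    simpa using pow_mul_exp_inv_tendsto 1 r one_ne_zero
  · have hc : ContinuousAt (fun v => v * Real.exp (-Real.pi * r ^ 2 / v ^ 2)
        + 2 * Real.pi * r ^ 2 * g (v⁻¹)) 1 := by
      refine ContinuousAt.add ?_ (ContinuousAt.mul continuousAt_const ?_)
      · exact continuousAt_id.mul (exp_inv_deriv r 1 one_ne_zero).continuousAt
      · exact ContinuousAt.comp (hg _).continuousAt (continuousAt_inv₀ one_ne_zero)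
    exact hc.tendsto.mono_left nhdsWithin_le_nhds

lemma J_succ (i : ℕ) (r : ℝ) : Jfun (i+1) r =
    (Real.exp (-Real.pi * r ^ 2) - 2 * Real.pi * r ^ 2 * Jfun i r) / (2 * i + 3) := by
  have key := intervalIntegral.integral_eq_sub_of_hasDerivAt_of_tendsto (a := 0) (b := 1)
    (f := fun v => v ^ (2 * i + 3) * Real.exp (-Real.pi * r ^ 2 / v ^ 2))
    (f' := fun v => (2 * i + 3) * (v ^ (2 * (i+1)) * Real.exp (-Real.pi * r ^ 2 / v ^ 2))
      + 2 * Real.pi * r ^ 2 * (v ^ (2 * i) * Real.exp (-Real.pi * r ^ 2 / v ^ 2)))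
    (fa := 0)
    (fb := 1 ^ (2 * i + 3) * Real.exp (-Real.pi * r ^ 2 / 1 ^ 2))
    one_pos ?_ (((J_integrable (i+1) r).const_mul _).add ((J_integrable i r).const_mul _))
    (pow_mul_exp_inv_tendsto _ r (by omega)) ?_
  · rw [intervalIntegral.integral_add ((J_integrable (i+1) r).const_mul _)
      ((J_integrable i r).const_mul _), intervalIntegral.integral_const_mul,
      intervalIntegral.integral_const_mul] at key
    change (2 * (i:ℝ) + 3) * Jfun (i+1) r + 2 * Real.pi * r ^ 2 * Jfun i r = _ at key
    have h3 : (2 * (i:ℝ) + 3) ≠ 0 := by positivity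
    rw [eq_div_iff h3]
    norm_num at key
    simp only [neg_mul] at key ⊢
    linarith
  · intro v hv
    have hv0 : v ≠ 0 := hv.1.ne'
    have := (hasDerivAt_pow (2 * i + 3) v).mul (exp_inv_deriv r v hv0)
    refine HasDerivAt.congr_deriv this ?_
    simp only [show 2 * i + 3 - 1 = 2 * (i+1) by omega]
    push_cast
    field_simp
    ring
  · have hc : ContinuousAt (fun v => v ^ (2 * i + 3) * Real.exp (-Real.pi * r ^ 2 / v ^ 2)) 1 :=
      (continuous_pow _).continuousAt.mul (exp_inv_deriv r 1 one_ne_zero).continuousAt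
    exact hc.tendsto.mono_left nhdsWithin_le_nhds

lemma J_formula (i : ℕ) : ∃ (c : ℝ) (S : ℝ → ℝ), (∀ N : ℕ, ContDiff ℝ N S) ∧
    ∀ r : ℝ, 0 ≤ r → Jfun i r = c * r ^ (2 * i + 1) + S (r ^ 2) := by
  induction i with
  | zero =>
    refine ⟨-Real.pi, fun ρ => Real.exp (-Real.pi * ρ) + 2 * Real.pi * ρ * Qfun 0 (Real.pi * ρ),
      fun N => ?_, fun r hr => J_zero r hr⟩
    have h1 : ContDiff ℝ N (fun ρ : ℝ => Qfun 0 (Real.pi * ρ)) :=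
      (Qfun_contDiff N 0).comp (by fun_prop)
    fun_prop
  | succ i ih =>
    obtain ⟨c, S, hS, h⟩ := ih
    refine ⟨- 2 * Real.pi * c / (2 * i + 3), fun ρ => (Real.exp (-Real.pi * ρ)
      - 2 * Real.pi * ρ * S ρ) / (2 * i + 3), fun N => ?_, fun r hr => ?_⟩
    · have := hS N
      fun_prop
    · rw [J_succ, h r hr]
      have h3 : (2 * (i:ℝ) + 3) ≠ 0 := by positivity
      field_simp
      ring

def mfun (i : ℕ) (r : ℝ) : ℝ := ∫ v in (0:ℝ)..1, v ^ (2 * i + 2) * Real.exp (-Real.pi * v ^ 2 * r ^ 2)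

def mC (i : ℕ) (η : ℂ) : ℂ := ((mfun i ‖η‖ : ℝ) : ℂ)

lemma mfun_continuous (i : ℕ) : Continuous (mfun i) := by
  unfold mfun
  apply intervalIntegral.continuous_parametric_intervalIntegral_of_continuous'
  fun_prop

lemma mfun_nonneg (i : ℕ) (r : ℝ) : 0 ≤ mfun i r := by
  apply intervalIntegral.integral_nonneg zero_le_one
  intro v hv
  have := hv.1
  positivity

lemma exp_neg_pow_bound (N : ℕ) (r : ℝ) (hr : 1 ≤ r) :
    Real.exp (-(Real.pi / 2) * r ^ 2) ≤ N.factorial * (r ^ N)⁻¹ := by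
  have h1 : Real.exp (-(Real.pi / 2) * r ^ 2) ≤ Real.exp (-r) := by
    apply Real.exp_le_exp.2
    have := Real.pi_gt_three
    nlinarith
  have h2 := Real.pow_div_factorial_le_exp r (by linarith) N
  rw [Real.exp_neg] at h1
  refine h1.trans ?_
  have h3 : 0 < r ^ N / N.factorial := by positivity
  calc (Real.exp r)⁻¹ ≤ (r ^ N / N.factorial)⁻¹ := inv_anti₀ h3 h2
    _ = _ := by rw [inv_div]; rfl

lemma pow_gauss_integrable (n : ℕ) {b : ℝ} (hb : 0 < b) :
    Integrable (fun v : ℝ => v ^ n * Real.exp (-b * v ^ 2)) := by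
  have := integrable_rpow_mul_exp_neg_mul_sq hb (s := n) (by have : (0:ℝ) ≤ n := n.cast_nonneg
                                                             linarith)
  simpa using this

lemma mfun_asymp (i : ℕ) : ∃ γ : ℝ, 0 < γ ∧ ∀ N : ℕ, ∃ C : ℝ, 0 ≤ C ∧ ∀ r : ℝ, 1 ≤ r →
    |mfun i r - γ * (r ^ (2 * i + 3))⁻¹| ≤ C * (r ^ N)⁻¹ := by
  have hpi := Real.pi_pos
  have hInt : ∀ r : ℝ, 0 < r →
      Integrable (fun v : ℝ => v ^ (2 * i + 2) * Real.exp (-Real.pi * v ^ 2 * r ^ 2)) := by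
    intro r hr
    have := pow_gauss_integrable (2 * i + 2) (b := Real.pi * r ^ 2) (by positivity)
    refine this.congr (Eventually.of_forall fun v => ?_)
    simp only
    congr 2; ring
  let γ : ℝ := ∫ v in Set.Ioi (0:ℝ), v ^ (2 * i + 2) * Real.exp (-Real.pi * v ^ 2 * 1 ^ 2)
  have hγ : 0 < γ := by
    have h1 := (hInt 1 one_pos).integrableOn (s := Set.Ioi 0)
    rw [setIntegral_pos_iff_support_of_nonneg_ae _ h1]
    · have : (Function.support fun v : ℝ => v ^ (2 * i + 2) * Real.exp (-Real.pi * v ^ 2 * 1 ^ 2))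
          ∩ Set.Ioi 0 = Set.Ioi 0 := by
        apply Set.inter_eq_right.2
        intro v hv
        have : (0:ℝ) < v := hv
        simp only [Function.mem_support]
        positivity
      rw [this]; simp
    · filter_upwards with v
      simp only [Pi.zero_apply]
      have : 0 ≤ v ^ (2 * i + 2) := Even.pow_nonneg ⟨i+1, by ring⟩ v
      positivity
  let T : ℝ := ∫ v in Set.Ioi (1:ℝ), v ^ (2 * i + 2) * Real.exp (-(Real.pi / 2) * v ^ 2)
  have hT0 : 0 ≤ T := by
    apply setIntegral_nonneg measurableSet_Ioi
    intro v hv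
    have : (1:ℝ) < v := hv
    positivity
  refine ⟨γ, hγ, fun N => ⟨T * N.factorial, by positivity, fun r hr => ?_⟩⟩
  have hr0 : 0 < r := by linarith
  have hsc : ∫ v in Set.Ioi (0:ℝ), v ^ (2 * i + 2) * Real.exp (-Real.pi * v ^ 2 * r ^ 2)
      = γ * (r ^ (2 * i + 3))⁻¹ := by
    have := integral_comp_mul_left_Ioi
      (fun v : ℝ => v ^ (2 * i + 2) * Real.exp (-Real.pi * v ^ 2 * 1 ^ 2)) 0 hr0
    rw [mul_zero] at this
    change _ = r⁻¹ • γ at this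
    rw [smul_eq_mul] at this
    have h2 : ∫ v in Set.Ioi (0:ℝ), v ^ (2 * i + 2) * Real.exp (-Real.pi * v ^ 2 * r ^ 2)
      = (r ^ (2 * i + 2))⁻¹ * ∫ v in Set.Ioi (0:ℝ), (r * v) ^ (2 * i + 2)
          * Real.exp (-Real.pi * (r * v) ^ 2 * 1 ^ 2) := by
      rw [← integral_const_mul]
      congr 1; ext v
      rw [mul_pow r v (2 * i + 2), ← mul_assoc, ← mul_assoc, inv_mul_cancel₀ (by positivity), one_mul]
      congr 2; ring
    rw [h2, this, show 2 * i + 3 = (2 * i + 2) + 1 by ring, pow_succ r (2 * i + 2), mul_inv]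
    ring
  have hsplit : ∫ v in Set.Ioi (0:ℝ), v ^ (2 * i + 2) * Real.exp (-Real.pi * v ^ 2 * r ^ 2)
      = mfun i r + ∫ v in Set.Ioi (1:ℝ), v ^ (2 * i + 2) * Real.exp (-Real.pi * v ^ 2 * r ^ 2) := by
    rw [mfun, intervalIntegral.integral_of_le zero_le_one, ← setIntegral_union
      (Set.Ioc_disjoint_Ioi le_rfl) measurableSet_Ioi (hInt r hr0).integrableOn
      (hInt r hr0).integrableOn, Set.Ioc_union_Ioi_eq_Ioi zero_le_one]
  have htail0 : 0 ≤ ∫ v in Set.Ioi (1:ℝ), v ^ (2 * i + 2) * Real.exp (-Real.pi * v ^ 2 * r ^ 2) := by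
    apply setIntegral_nonneg measurableSet_Ioi
    intro v hv
    have : (1:ℝ) < v := hv
    positivity
  have htail : ∫ v in Set.Ioi (1:ℝ), v ^ (2 * i + 2) * Real.exp (-Real.pi * v ^ 2 * r ^ 2)
      ≤ T * Real.exp (-(Real.pi / 2) * r ^ 2) := by
    rw [← integral_mul_const]
    refine setIntegral_mono_on (hInt r hr0).integrableOn
      ((pow_gauss_integrable _ (by positivity)).mul_const _).integrableOn measurableSet_Ioi ?_
    intro v hv
    have hv1 : (1:ℝ) < v := hv
    rw [mul_assoc (v ^ (2*i+2)), ← Real.exp_add]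
    gcongr
    have h1 : 1 ≤ v ^ 2 := one_le_pow₀ hv1.le
    have h2 : 1 ≤ r ^ 2 := one_le_pow₀ hr
    have : 0 ≤ Real.pi * ((v^2 - 1) * (r^2-1) + (v^2 * r^2 - 1)) := by
      have h3 : 1 ≤ v^2 * r^2 := one_le_mul_of_one_le_of_one_le h1 h2
      have h4 : 0 ≤ (v^2 - 1) * (r^2-1) := mul_nonneg (by linarith) (by linarith)
      apply mul_nonneg hpi.le; linarith
    nlinarith
  rw [← hsc, hsplit, sub_add_cancel_left, abs_neg, abs_of_nonneg htail0]
  refine htail.trans ?_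
  rw [mul_assoc]
  gcongr
  exact exp_neg_pow_bound N r hr

lemma gauss_norm_int (v : ℝ) (hv : 0 < v) :
    ∫ η : ℂ, Real.exp (-Real.pi * v ^ 2 * ‖η‖ ^ 2) = (v ^ 2)⁻¹ := by
  have h := GaussianFourier.integral_rexp_neg_mul_sq_norm (V := ℂ) (b := Real.pi * v ^ 2)
    (by have := Real.pi_pos; positivity)
  simp only [Complex.finrank_real_complex] at h
  norm_num at h
  have hpi := Real.pi_pos.ne'
  simp only [neg_mul] at h ⊢
  rw [h]; field_simp

open FourierTransform in
lemma mC_fourier (i : ℕ) (ξ : ℂ) : Integrable (mC i) ∧ 𝓕 (mC i) ξ = ((Jfun i ‖ξ‖ : ℝ) : ℂ) := by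
  have hpi := Real.pi_pos
  have hprod : Integrable (Function.uncurry fun (η : ℂ) (v : ℝ) =>
      (v ^ (2 * i + 2) * Real.exp (-Real.pi * v ^ 2 * ‖η‖ ^ 2)))
      (volume.prod (volume.restrict (Set.Ioc (0:ℝ) 1))) := by
    rw [integrable_prod_iff']
    · constructor
      · rw [ae_restrict_iff' measurableSet_Ioc]
        refine Eventually.of_forall fun v hv => ?_
        have hv0 := hv.1
        simp only [Function.uncurry]
        apply Integrable.const_mul
        apply Integrable.of_integral_ne_zero
        simp only [gauss_norm_int v hv0]; positivity
      · have : Integrable (fun v : ℝ => v ^ (2 * i)) (volume.restrict (Set.Ioc (0:ℝ) 1)) := by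
          have : IntervalIntegrable (fun v : ℝ => v ^ (2 * i)) volume 0 1 :=
            (continuous_pow _).intervalIntegrable _ _
          exact this.1
        refine this.congr ?_
        rw [Filter.EventuallyEq, ae_restrict_iff' measurableSet_Ioc]
        refine Eventually.of_forall fun v hv => ?_
        have hv0 := hv.1
        have : ∀ η : ℂ, ‖Function.uncurry (fun (η : ℂ) (v : ℝ) =>
          (v ^ (2 * i + 2) * Real.exp (-Real.pi * v ^ 2 * ‖η‖ ^ 2))) (η, v)‖
          = v ^ (2 * i + 2) * Real.exp (-Real.pi * v ^ 2 * ‖η‖ ^ 2) := by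
          intro η
          simp only [Function.uncurry]
          exact Real.norm_of_nonneg (by positivity)
        simp only [this]
        rw [integral_const_mul, gauss_norm_int v hv0]
        field_simp
        ring
    · refine Continuous.aestronglyMeasurable ?_
      unfold Function.uncurry
      fun_prop
  have hm : ∀ η : ℂ, mC i η = ∫ v in Set.Ioc (0:ℝ) 1,
      ((v ^ (2 * i + 2) * Real.exp (-Real.pi * v ^ 2 * ‖η‖ ^ 2) : ℝ) : ℂ) := by
    intro η
    rw [mC, mfun, intervalIntegral.integral_of_le zero_le_one, ← integral_complex_ofReal]
  constructor
  · have := (hprod.integral_prod_left).ofReal (𝕜 := ℂ)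
    refine this.congr (Eventually.of_forall fun η => ?_)
    simp only [hm, Function.uncurry]
    rw [integral_complex_ofReal]; rfl
  · rw [Real.fourier_eq]
    have e1 : ∀ η : ℂ, Real.fourierChar (-(inner ℝ η ξ)) • mC i η = ∫ v in Set.Ioc (0:ℝ) 1,
        Real.fourierChar (-(inner ℝ η ξ)) •
        ((v ^ (2 * i + 2) * Real.exp (-Real.pi * v ^ 2 * ‖η‖ ^ 2) : ℝ) : ℂ) := by
      intro η
      rw [hm]
      simp only [Circle.smul_def]
      rw [integral_smul]
    simp_rw [e1]
    rw [integral_integral_swap]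
    · rw [Jfun, intervalIntegral.integral_of_le zero_le_one, ← integral_complex_ofReal]
      refine setIntegral_congr_fun measurableSet_Ioc fun v hv => ?_
      have hv0 := hv.1
      have hg := fourier_gaussian_innerProductSpace (V := ℂ) (b := ((Real.pi * v ^ 2 : ℝ) : ℂ))
        (by rw [Complex.ofReal_re]; positivity) ξ
      rw [Real.fourier_eq] at hg
      have e2 : ∀ η : ℂ, Real.fourierChar (-(inner ℝ η ξ)) •
        ((v ^ (2 * i + 2) * Real.exp (-Real.pi * v ^ 2 * ‖η‖ ^ 2) : ℝ) : ℂ)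
        = ((v ^ (2 * i + 2) : ℝ) : ℂ) * (Real.fourierChar (-(inner ℝ η ξ)) •
          Complex.exp (-((Real.pi * v ^ 2 : ℝ) : ℂ) * ‖η‖ ^ 2)) := by
        intro η
        simp only [Circle.smul_def, smul_eq_mul]
        push_cast
        rw [neg_mul]; ring
      simp_rw [e2]
      rw [integral_const_mul, hg, Complex.finrank_real_complex]
      have hv' : (v : ℂ) ≠ 0 := by exact_mod_cast hv0.ne'
      have hpi' : (Real.pi : ℂ) ≠ 0 := by exact_mod_cast hpi.ne'
      have e3 : ((2:ℕ) : ℂ) / 2 = 1 := by norm_num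
      rw [e3, Complex.cpow_one]
      push_cast
      have e4 : -(Real.pi : ℂ) ^ 2 * (‖ξ‖ : ℂ) ^ 2 / (Real.pi * v ^ 2) = -Real.pi * ‖ξ‖ ^ 2 / v ^ 2 := by
        field_simp
      rw [e4]
      field_simp
      ring
    · have h2 := hprod.ofReal (𝕜 := ℂ)
      refine h2.mono ?_ ?_
      · refine Continuous.aestronglyMeasurable ?_
        unfold Function.uncurry
        simp only [Circle.smul_def]
        fun_prop
      · refine Eventually.of_forall fun p => ?_
        simp [Function.uncurry]

lemma decay_moment (W : ℂ → ℂ) (hW : AEStronglyMeasurable W) (N l : ℕ) (hl : l ≤ N) (C : ℝ)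
    (h : ∀ η, ‖W η‖ ≤ C * ((1 + ‖η‖) ^ (N + 3))⁻¹) :
    Integrable (fun η => ‖η‖ ^ l * ‖W η‖) := by
  have h0 := integrable_one_add_norm (E := ℂ) (μ := volume) (r := 3)
    (by rw [Complex.finrank_real_complex]; norm_num)
  have h1 : Integrable (fun η : ℂ => C * ((1 + ‖η‖) ^ 3)⁻¹) := by
    refine (h0.const_mul C).congr (Eventually.of_forall fun η => ?_)
    simp only
    rw [Real.rpow_neg (by positivity)]
    norm_cast
  refine h1.mono ?_ (Eventually.of_forall fun η => ?_)
  · exact (Continuous.aestronglyMeasurable (by fun_prop)).mul hW.norm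
  · rw [Real.norm_of_nonneg (by positivity)]
    refine le_trans ?_ (le_abs_self _)
    have hC : 0 ≤ C * ((1 + ‖η‖) ^ (N + 3))⁻¹ := (norm_nonneg _).trans (h η)
    have a : ‖η‖ ^ l ≤ (1 + ‖η‖) ^ N := by
      calc ‖η‖ ^ l ≤ (1 + ‖η‖) ^ l := by gcongr; linarith
        _ ≤ (1 + ‖η‖) ^ N := by
          apply pow_le_pow_right₀ _ hl
          linarith [norm_nonneg η]
    calc ‖η‖ ^ l * ‖W η‖ ≤ (1 + ‖η‖) ^ N * (C * ((1 + ‖η‖) ^ (N + 3))⁻¹) := by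
          gcongr; exact h η
      _ = C * ((1 + ‖η‖) ^ 3)⁻¹ := by
          have : 1 + ‖η‖ ≠ 0 := by positivity
          rw [pow_add]; field_simp

open FourierTransform in
lemma decay_contDiff (W : ℂ → ℂ) (hW : AEStronglyMeasurable W) (N : ℕ) (C : ℝ)
    (h : ∀ η, ‖W η‖ ≤ C * ((1 + ‖η‖) ^ (N + 3))⁻¹) :
    ContDiff ℝ N (𝓕 W) := by
  have := Real.contDiff_fourier (f := W) (N := (N : ℕ∞)) (fun n hn =>
    decay_moment W hW N n (by exact_mod_cast hn) C h)
  exact_mod_cast this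

lemma decay_integrable (W : ℂ → ℂ) (hW : AEStronglyMeasurable W) (N : ℕ) (C : ℝ)
    (h : ∀ η, ‖W η‖ ≤ C * ((1 + ‖η‖) ^ (N + 3))⁻¹) : Integrable W := by
  have := decay_moment W hW N 0 (Nat.zero_le _) C h
  simp only [pow_zero, one_mul] at this
  exact (integrable_norm_iff hW).1 this

lemma decay_of_large (W : ℂ → ℂ) (hb : ∃ B, ∀ η, ‖η‖ ≤ 1 → ‖W η‖ ≤ B) (k : ℕ)
    (hl : ∃ C, 0 ≤ C ∧ ∀ η, 1 ≤ ‖η‖ → ‖W η‖ ≤ C * (‖η‖ ^ k)⁻¹) :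
    ∃ C, 0 ≤ C ∧ ∀ η, ‖W η‖ ≤ C * ((1 + ‖η‖) ^ k)⁻¹ := by
  obtain ⟨B, hB⟩ := hb
  obtain ⟨C, hC, hl⟩ := hl
  have hB0 : 0 ≤ B := (norm_nonneg _).trans (hB 0 (by simp))
  refine ⟨(B + C) * 2 ^ k, by positivity, fun η => ?_⟩
  rw [mul_assoc]
  rcases le_total ‖η‖ 1 with h1 | h1
  · refine (hB η h1).trans ?_
    have : 1 ≤ 2 ^ k * ((1 + ‖η‖) ^ k)⁻¹ := by
      rw [← div_eq_mul_inv, one_le_div (by positivity)]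
      gcongr; linarith
    nlinarith
  · refine (hl η h1).trans ?_
    have : (‖η‖ ^ k)⁻¹ ≤ 2 ^ k * ((1 + ‖η‖) ^ k)⁻¹ := by
      rw [← div_eq_mul_inv, le_div_iff₀ (by positivity), inv_mul_le_iff₀ (by positivity), ← mul_pow]
      gcongr; linarith
    calc C * (‖η‖ ^ k)⁻¹ ≤ C * (2 ^ k * ((1 + ‖η‖) ^ k)⁻¹) := by gcongr
      _ ≤ _ := by gcongr; linarith

lemma mC_continuous (i : ℕ) : Continuous (mC i) := by
  unfold mC
  have := mfun_continuous i
  fun_prop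

lemma mC_norm (i : ℕ) (η : ℂ) : ‖mC i η‖ = mfun i ‖η‖ := by
  rw [mC, Complex.norm_real, Real.norm_of_nonneg (mfun_nonneg _ _)]

lemma mC_decay (i : ℕ) : ∃ C, 0 ≤ C ∧ ∀ η, ‖mC i η‖ ≤ C * ((1 + ‖η‖) ^ (2 * i + 3))⁻¹ := by
  apply decay_of_large
  · have := (isCompact_closedBall (0:ℂ) 1).exists_bound_of_continuousOn (mC_continuous i).continuousOn
    obtain ⟨B, hB⟩ := this
    exact ⟨B, fun η h => hB η (by simpa using h)⟩
  · obtain ⟨γ, hγ, h⟩ := mfun_asymp i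
    obtain ⟨C, hC, h⟩ := h (2 * i + 3)
    refine ⟨C + γ, by positivity, fun η hη => ?_⟩
    rw [mC_norm, add_mul]
    have := (abs_le.1 (h _ hη)).2
    linarith

def dirProd : List ℂ → ℂ → ℝ
  | [], _ => 1
  | v :: l, η => inner ℝ η v * dirProd l η

lemma dirProd_continuous (l : List ℂ) : Continuous (dirProd l) := by
  induction l with
  | nil => exact continuous_const
  | cons v l ih => 
    change Continuous (fun η => inner ℝ η v * dirProd l η)
    fun_prop

lemma dirProd_bound (l : List ℂ) : ∃ C, 0 ≤ C ∧ ∀ η, |dirProd l η| ≤ C * ‖η‖ ^ l.length := by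
  induction l with
  | nil => exact ⟨1, zero_le_one, fun η => by simp [dirProd]⟩
  | cons v l ih =>
    obtain ⟨C, hC, h⟩ := ih
    refine ⟨‖v‖ * C, by positivity, fun η => ?_⟩
    rw [dirProd, abs_mul, List.length_cons, pow_succ]
    calc _ ≤ (‖η‖ * ‖v‖) * (C * ‖η‖ ^ l.length) := by
          gcongr
          · exact abs_real_inner_le_norm η v
          · exact h η
      _ = _ := by ring

def modelW (l : List ℂ) (i : ℕ) (η : ℂ) : ℂ := (dirProd l η : ℂ) * mC i η

lemma modelW_continuous (l : List ℂ) (i : ℕ) : Continuous (modelW l i) := by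
  unfold modelW
  have := mC_continuous i
  have := dirProd_continuous l
  fun_prop

lemma modelW_decay (l : List ℂ) (i k : ℕ) (hk : l.length + k = 2 * i + 3) :
    ∃ C, 0 ≤ C ∧ ∀ η, ‖modelW l i η‖ ≤ C * ((1 + ‖η‖) ^ k)⁻¹ := by
  obtain ⟨A, hA, h1⟩ := dirProd_bound l
  obtain ⟨B, hB, h2⟩ := mC_decay i
  refine ⟨A * B, by positivity, fun η => ?_⟩
  rw [modelW, norm_mul, Complex.norm_real, Real.norm_eq_abs]
  calc _ ≤ (A * (1 + ‖η‖) ^ l.length) * (B * ((1 + ‖η‖) ^ (2 * i + 3))⁻¹) := by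
        gcongr
        · refine (h1 η).trans ?_
          gcongr; linarith
        · exact h2 η
    _ = _ := by
        have : 1 + ‖η‖ ≠ 0 := by positivity
        rw [← hk, pow_add]; field_simp

lemma norm_pow_hasFDerivAt (k : ℕ) (ξ : ℂ) :
    HasFDerivAt (fun x : ℂ => ‖x‖ ^ (k + 3)) ((((k:ℝ) + 3) * ‖ξ‖ ^ (k + 1)) • innerSL ℝ ξ) ξ := by
  have := hasFDerivAt_norm_rpow ξ (p := (k:ℝ) + 3) (by linarith [(k.cast_nonneg : (0:ℝ) ≤ k)])
  have e : ((k:ℝ) + 3 - 2) = ((k + 1 : ℕ) : ℝ) := by push_cast; ring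
  have e2 : ((k:ℝ) + 3) = ((k + 3 : ℕ) : ℝ) := by push_cast; ring
  rw [e, Real.rpow_natCast] at this
  refine this.congr_of_eventuallyEq (Eventually.of_forall fun x => ?_)
  simp only
  rw [e2, Real.rpow_natCast]

lemma contDiff_dir (P : ℂ → ℂ) (hP : ∀ N : ℕ, ContDiff ℝ N P) (v : ℂ) (N : ℕ) :
    ContDiff ℝ N (fun ξ => fderiv ℝ P ξ v) := by
  have := hP (N + 1)
  have e : ((N+1:ℕ):WithTop ℕ∞) = (N:WithTop ℕ∞)+1 := by push_cast; rfl
  rw [e] at this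
  exact (this.fderiv_right le_rfl).clm_apply contDiff_const

open FourierTransform in
lemma model_fourier (i : ℕ) (l : List ℂ) (k : ℕ) (hk : 2 * i = 2 * l.length + k) :
    ∃ P S : ℂ → ℂ, (∀ N : ℕ, ContDiff ℝ N P) ∧ (∀ N : ℕ, ContDiff ℝ N S) ∧
      (∀ (L : ℝ) x, P (L • x) = ((L ^ l.length : ℝ) : ℂ) * P x) ∧
      ∀ ξ, 𝓕 (modelW l i) ξ = ((‖ξ‖ ^ (k + 1) : ℝ) : ℂ) * P ξ + S ξ := by
  induction l generalizing k with
  | nil =>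
    obtain ⟨c, S, hS, h⟩ := J_formula i
    refine ⟨fun _ => c, fun ξ => ((S (‖ξ‖ ^ 2) : ℝ) : ℂ), fun N => contDiff_const, fun N => ?_, ?_, ?_⟩
    · exact Complex.ofRealCLM.contDiff.comp ((hS N).comp (contDiff_norm_sq ℝ))
    · intro L x; simp
    · intro ξ
      have : modelW [] i = mC i := by
        ext η; simp [modelW, dirProd]
      rw [this, (mC_fourier i ξ).2, h _ (norm_nonneg _)]
      simp only [List.length_nil, mul_zero, zero_add] at hk
      rw [hk]; push_cast; ring
  | cons v l ih =>
    obtain ⟨P, S, hP, hS, hhom, h⟩ := ih (k + 2) (by rw [hk, List.length_cons]; ring)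
    rw [List.length_cons] at hk
    have hPd : Differentiable ℝ P := (hP 1).differentiable (by norm_num)
    have hSd : Differentiable ℝ S := (hS 1).differentiable (by norm_num)
    let c : ℂ := Complex.I / (2 * Real.pi)
    refine ⟨fun ξ => c * (((k:ℂ) + 3) * ((inner ℝ ξ v : ℝ) : ℂ) * P ξ +
      ((‖ξ‖ ^ 2 : ℝ) : ℂ) * fderiv ℝ P ξ v), fun ξ => c * fderiv ℝ S ξ v, ?_, ?_, ?_, ?_⟩
    · intro N
      have h1 := hP N
      have h2 := contDiff_dir P hP v N
      have h3 : ContDiff ℝ N (fun ξ : ℂ => ((inner ℝ ξ v : ℝ) : ℂ)) :=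
        Complex.ofRealCLM.contDiff.comp (contDiff_id.inner ℝ contDiff_const)
      have h4 : ContDiff ℝ N (fun ξ : ℂ => ((‖ξ‖ ^ 2 : ℝ) : ℂ)) :=
        Complex.ofRealCLM.contDiff.comp (contDiff_norm_sq ℝ)
      exact contDiff_const.mul (((contDiff_const.mul h3).mul h1).add (h4.mul h2))
    · intro N
      exact contDiff_const.mul (contDiff_dir S hS v N)
    · intro L x
      have hd : (L : ℂ) * fderiv ℝ P (L • x) v = ((L ^ l.length : ℝ) : ℂ) * fderiv ℝ P x v := by
        have e1 : HasFDerivAt (fun x => P (L • x)) (L • fderiv ℝ P (L • x)) x := by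
          have := (hPd (L • x)).hasFDerivAt.comp x ((hasFDerivAt_id x).const_smul L)
          refine this.congr_fderiv ?_
          ext w; simp
        have e2 : HasFDerivAt (fun x => P (L • x)) (((L ^ l.length : ℝ) : ℂ) • fderiv ℝ P x) x := by
          simp only [hhom]
          exact (hPd x).hasFDerivAt.const_mul _
        have := congrArg (fun A => A v) (e1.unique e2)
        simpa using this
      simp only [hhom, List.length_cons, norm_smul, inner_smul_left, mul_pow, Real.norm_eq_abs, sq_abs]
      push_cast at hd ⊢
      simp only [conj_trivial]
      rw [pow_succ (L:ℂ) l.length]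
      linear_combination (c * L * (‖x‖:ℂ)^2) * hd
    · intro ξ
      obtain ⟨C, hC, hdec⟩ := modelW_decay l i (l.length + k + 5) (by rw [hk]; ring)
      have hmeas : AEStronglyMeasurable (modelW l i) := (modelW_continuous l i).aestronglyMeasurable
      have hInt := decay_integrable (modelW l i) hmeas (l.length + k + 2) C hdec
      have hInt1 := decay_moment (modelW l i) hmeas (l.length + k + 2) 1 (by omega) C hdec
      simp only [pow_one] at hInt1
      have hder := Real.hasFDerivAt_fourier hInt hInt1 ξ
      have hF : 𝓕 (modelW l i) = fun ξ => ((‖ξ‖ ^ (k + 3) : ℝ) : ℂ) * P ξ + S ξ := by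
        ext ξ; rw [h ξ]
      have hn : HasFDerivAt (fun x : ℂ => ((‖x‖ ^ (k + 3) : ℝ) : ℂ))
          (Complex.ofRealCLM.comp ((((k:ℝ) + 3) * ‖ξ‖ ^ (k + 1)) • innerSL ℝ ξ)) ξ :=
        Complex.ofRealCLM.hasFDerivAt.comp ξ (norm_pow_hasFDerivAt k ξ)
      have hder2 := (hn.mul (hPd ξ).hasFDerivAt).add (hSd ξ).hasFDerivAt
      rw [hF] at hder
      have hu := congrArg (fun A => A v) (hder.unique hder2)
      rw [Real.fourier_continuousLinearMap_apply] at hu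
      · have hw : (fun x => (VectorFourier.fourierSMulRight (innerSL ℝ) (modelW l i) x) v)
          = (-(2 * (Real.pi:ℂ) * Complex.I)) • modelW (v :: l) i := by
          ext x
          rw [VectorFourier.fourierSMulRight_apply]
          have hin : (innerSL ℝ x) v = (inner ℝ x v : ℝ) := rfl
          simp only [modelW, dirProd, hin, Pi.smul_apply, smul_eq_mul, Complex.real_smul]
          push_cast; ring
        rw [hw] at hu
        have hlin : 𝓕 ((-(2 * (Real.pi:ℂ) * Complex.I)) • modelW (v :: l) i) ξ =
          (-(2 * (Real.pi:ℂ) * Complex.I)) * 𝓕 (modelW (v :: l) i) ξ := by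
          rw [Real.fourier_eq, Real.fourier_eq, ← integral_const_mul]
          congr 1; ext x
          simp only [Circle.smul_def, Pi.smul_apply, smul_eq_mul]; ring
        rw [hlin] at hu
        simp only [add_apply, smul_apply,
          ContinuousLinearMap.comp_apply, innerSL_apply_apply, smul_eq_mul, Complex.ofRealCLM_apply] at hu
        have hpi' : (Real.pi : ℂ) ≠ 0 := by exact_mod_cast Real.pi_ne_zero
        have hI : Complex.I * Complex.I = -1 := Complex.I_mul_I
        have hc : c * (-(2 * (Real.pi:ℂ) * Complex.I)) = 1 := by
          simp only [c]; field_simp; rw [pow_two, hI]; ring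
        push_cast at hu ⊢
        linear_combination (-𝓕 (modelW (v :: l) i) ξ) * hc + c * hu
      · refine (hInt1.const_mul (2 * Real.pi * ‖(innerSL ℝ : ℂ →L[ℝ] ℂ →L[ℝ] ℝ)‖)).mono' ?_ ?_
        · exact hmeas.fourierSMulRight
        · refine Eventually.of_forall fun x => ?_
          have := VectorFourier.norm_fourierSMulRight_le (innerSL ℝ) (modelW l i) x
          linarith

open FourierTransform in
lemma model_main (e n : ℕ) (l : List ℂ) (hl : l.length = n) :
    ∃ P S : ℂ → ℂ, (∀ N : ℕ, ContDiff ℝ N P) ∧ (∀ N : ℕ, ContDiff ℝ N S) ∧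
      (∀ (L : ℝ) x, P (L • x) = ((L ^ n : ℝ) : ℂ) * P x) ∧
      (∀ ξ, 𝓕 (modelW l (n + e)) ξ = ((‖ξ‖ ^ (2 * e + 1) : ℝ) : ℂ) * P ξ + S ξ) ∧
      ContDiff ℝ n (fun ξ => ((‖ξ‖ ^ (2 * e + 1) : ℝ) : ℂ) * P ξ) ∧
      Integrable (modelW l (n + e)) := by
  obtain ⟨P, S, hP, hS, hh, hF⟩ := model_fourier (n + e) l (2 * e) (by rw [hl]; ring)
  rw [hl] at hh
  have hmeas : AEStronglyMeasurable (modelW l (n+e)) := (modelW_continuous l _).aestronglyMeasurable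
  obtain ⟨C, hC, hdec⟩ := modelW_decay l (n+e) (n + 2 * e + 3) (by rw [hl]; ring)
  refine ⟨P, S, hP, hS, hh, hF, ?_, decay_integrable _ hmeas _ C hdec⟩
  have h1 := decay_contDiff _ hmeas (n + 2 * e) C hdec
  have h2 : ContDiff ℝ n (𝓕 (modelW l (n + e))) := h1.of_le (by exact_mod_cast Nat.le_add_right _ _)
  have h3 := h2.sub (hS n)
  have e : (fun ξ => ((‖ξ‖ ^ (2 * e + 1) : ℝ) : ℂ) * P ξ) = fun ξ => 𝓕 (modelW l (n + e)) ξ - S ξ := by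
    ext ξ; rw [hF]; ring
  rw [e]; exact h3

open FourierTransform in
lemma fourier_sum_lin {ι : Type*} (s : Finset ι) (c : ι → ℂ) (W : ι → ℂ → ℂ)
    (hW : ∀ x ∈ s, Integrable (W x)) (ξ : ℂ) :
    𝓕 (fun η => ∑ x ∈ s, c x * W x η) ξ = ∑ x ∈ s, c x * 𝓕 (W x) ξ := by
  simp only [Real.fourier_eq]
  simp_rw [← integral_const_mul]
  rw [← integral_finset_sum]
  · congr 1; ext η
    simp only [Circle.smul_def, smul_eq_mul, Finset.mul_sum]
    apply Finset.sum_congr rfl; intros; ring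
  · intro x hx
    exact ((Real.fourierIntegral_convergent_iff ξ).2 (hW x hx)).const_mul _

open FourierTransform in
lemma fourier_sub_lin (f g : ℂ → ℂ) (hf : Integrable f) (hg : Integrable g) (ξ : ℂ) :
    𝓕 (fun η => f η - g η) ξ = 𝓕 f ξ - 𝓕 g ξ := by
  simp only [Real.fourier_eq]
  rw [← integral_sub ((Real.fourierIntegral_convergent_iff ξ).2 hf)
    ((Real.fourierIntegral_convergent_iff ξ).2 hg)]
  congr 1; ext η
  simp only [Circle.smul_def, smul_eq_mul]; ring

def monoList (n j : ℕ) : List ℂ := List.replicate j 1 ++ List.replicate (n - j) Complex.I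

lemma monoList_length (n j : ℕ) (h : j ≤ n) : (monoList n j).length = n := by
  simp [monoList]; omega

lemma dirProd_append (l l' : List ℂ) (η : ℂ) : dirProd (l ++ l') η = dirProd l η * dirProd l' η := by
  induction l with
  | nil => simp [dirProd]
  | cons v l ih => simp only [List.cons_append, dirProd, ih]; ring

lemma dirProd_replicate (n : ℕ) (v η : ℂ) : dirProd (List.replicate n v) η = (inner ℝ η v : ℝ) ^ n := by
  induction n with
  | zero => simp [dirProd]
  | succ n ih => simp only [List.replicate_succ, dirProd, ih]; ring

lemma dirProd_monoList (n j : ℕ) (η : ℂ) :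
    dirProd (monoList n j) η = η.re ^ j * η.im ^ (n - j) := by
  rw [monoList, dirProd_append, dirProd_replicate, dirProd_replicate]
  simp [Complex.inner]

open FourierTransform in
lemma model_comb (e n : ℕ) (p : ℕ → ℂ) : ∃ W P S : ℂ → ℂ, Continuous W ∧ Integrable W ∧
      (∀ N : ℕ, ContDiff ℝ N P) ∧ (∀ N : ℕ, ContDiff ℝ N S) ∧
      (∀ (L : ℝ) x, P (L • x) = ((L ^ n : ℝ) : ℂ) * P x) ∧
      (∀ ξ, 𝓕 W ξ = ((‖ξ‖ ^ (2 * e + 1) : ℝ) : ℂ) * P ξ + S ξ) ∧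
      ContDiff ℝ n (fun ξ => ((‖ξ‖ ^ (2 * e + 1) : ℝ) : ℂ) * P ξ) ∧
      ∀ K : ℕ, ∃ C : ℝ, 0 ≤ C ∧ ∀ η : ℂ, 1 ≤ ‖η‖ →
        ‖((‖η‖ ^ (2 * e + 3 + 2 * n) : ℝ) : ℂ)⁻¹ * (∑ j ∈ Finset.range (n + 1),
          p j * ((η.re ^ j * η.im ^ (n - j) : ℝ) : ℂ)) - W η‖ ≤ C * (‖η‖ ^ K)⁻¹ := by
  obtain ⟨γ, hγ, hasym⟩ := mfun_asymp (n + e)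
  have hγ' : (γ : ℂ) ≠ 0 := by exact_mod_cast hγ.ne'
  have hmm : ∀ j : ℕ, ∃ P S : ℂ → ℂ, j ∈ Finset.range (n + 1) →
    ((∀ N : ℕ, ContDiff ℝ N P) ∧ (∀ N : ℕ, ContDiff ℝ N S) ∧
      (∀ (L : ℝ) x, P (L • x) = ((L ^ n : ℝ) : ℂ) * P x) ∧
      (∀ ξ, 𝓕 (modelW (monoList n j) (n + e)) ξ = ((‖ξ‖ ^ (2 * e + 1) : ℝ) : ℂ) * P ξ + S ξ) ∧
      ContDiff ℝ n (fun ξ => ((‖ξ‖ ^ (2 * e + 1) : ℝ) : ℂ) * P ξ) ∧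
      Integrable (modelW (monoList n j) (n + e))) := by
    intro j
    by_cases hj : j ∈ Finset.range (n + 1)
    · obtain ⟨P, S, h⟩ := model_main e n (monoList n j) (monoList_length n j (by
        have := Finset.mem_range.1 hj; omega))
      exact ⟨P, S, fun _ => h⟩
    · exact ⟨0, 0, fun h => absurd h hj⟩
  choose P S h using hmm
  refine ⟨fun η => ∑ j ∈ Finset.range (n + 1), (p j / γ) * modelW (monoList n j) (n + e) η,
    fun ξ => ∑ j ∈ Finset.range (n + 1), (p j / γ) * P j ξ,
    fun ξ => ∑ j ∈ Finset.range (n + 1), (p j / γ) * S j ξ, ?_, ?_, ?_, ?_, ?_, ?_, ?_, ?_⟩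
  · apply continuous_finset_sum
    intro j _
    exact continuous_const.mul (modelW_continuous _ _)
  · apply integrable_finset_sum
    intro j hj
    exact (h j hj).2.2.2.2.2.const_mul _
  · intro N
    apply ContDiff.sum
    intro j hj
    exact contDiff_const.mul ((h j hj).1 N)
  · intro N
    apply ContDiff.sum
    intro j hj
    exact contDiff_const.mul ((h j hj).2.1 N)
  · intro L x
    rw [Finset.mul_sum]
    apply Finset.sum_congr rfl
    intro j hj
    rw [(h j hj).2.2.1]; ring
  · intro ξ
    rw [fourier_sum_lin _ (fun j => p j / γ) (fun j => modelW (monoList n j) (n + e))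
      (fun j hj => (h j hj).2.2.2.2.2), Finset.mul_sum, ← Finset.sum_add_distrib]
    apply Finset.sum_congr rfl
    intro j hj
    rw [(h j hj).2.2.2.1]; ring
  · simp_rw [Finset.mul_sum]
    apply ContDiff.sum
    intro j hj
    have := (contDiff_const (c := p j / (γ:ℂ))).mul (h j hj).2.2.2.2.1
    have e : (fun ξ => ((‖ξ‖ ^ (2 * e + 1) : ℝ) : ℂ) * ((p j / γ) * P j ξ)) =
      fun ξ => (p j / γ) * (((‖ξ‖ ^ (2 * e + 1) : ℝ) : ℂ) * P j ξ) := by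
      ext ξ; ring
    rw [e]; exact this
  · intro K
    obtain ⟨C, hC, hasym⟩ := hasym (K + n)
    have hb : ∀ j : ℕ, ∃ A, 0 ≤ A ∧ (j ∈ Finset.range (n + 1) → ∀ η, |dirProd (monoList n j) η| ≤ A * ‖η‖ ^ n) := by
      intro j
      obtain ⟨A, hA, h⟩ := dirProd_bound (monoList n j)
      refine ⟨A, hA, fun hj η => ?_⟩
      have := h η
      rwa [monoList_length n j (by have := Finset.mem_range.1 hj; omega)] at this
    choose A hA hb using hb
    refine ⟨∑ j ∈ Finset.range (n + 1), ‖p j / γ‖ * (A j * C),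
      Finset.sum_nonneg fun j _ => by have := hA j; positivity, fun η hη => ?_⟩
    rw [Finset.mul_sum, ← Finset.sum_sub_distrib, Finset.sum_mul]
    refine norm_sum_le_of_le _ fun j hj => ?_
    have hη0 : (0:ℝ) < ‖η‖ := by linarith
    have e1 : ((‖η‖ ^ (2 * e + 3 + 2 * n) : ℝ) : ℂ)⁻¹ * (p j * ((η.re ^ j * η.im ^ (n - j) : ℝ) : ℂ))
      - (p j / γ) * modelW (monoList n j) (n + e) η = - ((p j / γ) * ((dirProd (monoList n j) η *
        (mfun (n + e) ‖η‖ - γ * (‖η‖ ^ (2 * (n + e) + 3))⁻¹) : ℝ) : ℂ)) := by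
      rw [modelW, mC, dirProd_monoList, show 2 * (n + e) + 3 = 2 * e + 3 + 2 * n by ring]
      push_cast
      field_simp
      ring
    rw [e1, norm_neg, norm_mul, Complex.norm_real, Real.norm_eq_abs, abs_mul]
    have h1 := hb j hj η
    have h2 := hasym ‖η‖ hη
    calc _ ≤ ‖p j / γ‖ * ((A j * ‖η‖ ^ n) * (C * (‖η‖ ^ (K + n))⁻¹)) := by
          have := hA j
          gcongr
      _ = _ := by rw [pow_add]; field_simp

open FourierTransform in
lemma fourier_germ (e : ℕ) (M : ℂ → ℂ) (hM : Continuous M) (p : ℕ → ℕ → ℂ)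
    (hasym : ∀ N : ℕ, ∃ C : ℝ, 0 ≤ C ∧ ∀ η : ℂ, 1 ≤ ‖η‖ →
      ‖M η - ∑ n ∈ Finset.range N, ((‖η‖ ^ (2 * e + 3 + 2 * n) : ℝ) : ℂ)⁻¹ *
        (∑ j ∈ Finset.range (n + 1), p n j * ((η.re ^ j * η.im ^ (n - j) : ℝ) : ℂ))‖
        ≤ C * (‖η‖ ^ (2 * e + 3 + N))⁻¹) :
    Integrable M ∧ ∃ C₀ C₁ : ℂ → ℂ, (∀ n : ℕ, ContDiff ℝ n C₀) ∧ (∀ n : ℕ, ContDiff ℝ n C₁) ∧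
      ∀ ξ, 𝓕 M ξ = C₀ ξ + C₁ ξ * ((‖ξ‖ ^ (2 * e + 1) : ℝ) : ℂ) := by
  choose W P S hWc hWi hP hS hhom hF hsm has using fun n => model_comb e n (p n)
  have key : ∀ N : ℕ, ∃ C, 0 ≤ C ∧ ∀ η, ‖M η - ∑ n ∈ Finset.range N, 1 * W n η‖ ≤
      C * ((1 + ‖η‖) ^ ((2 * e + N) + 3))⁻¹ := by
    intro N
    apply decay_of_large
    · have hc : Continuous (fun η => M η - ∑ n ∈ Finset.range N, 1 * W n η) := by
        refine hM.sub (continuous_finset_sum _ fun n _ => continuous_const.mul (hWc n))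
      obtain ⟨B, hB⟩ := (isCompact_closedBall (0:ℂ) 1).exists_bound_of_continuousOn hc.continuousOn
      exact ⟨B, fun η h => hB η (by simpa using h)⟩
    · obtain ⟨C, hC, h⟩ := hasym N
      choose D hD has using fun n => has n (2 * e + 3 + N)
      refine ⟨C + ∑ n ∈ Finset.range N, D n, add_nonneg hC (Finset.sum_nonneg fun n _ => hD n),
        fun η hη => ?_⟩
      rw [add_mul, Finset.sum_mul, show 2 * e + N + 3 = 2 * e + 3 + N by ring]
      have := norm_add_le_of_le (h η hη) (norm_sum_le_of_le (Finset.range N) fun n _ => has n η hη)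
      refine le_trans (le_of_eq ?_) this
      congr 1
      rw [Finset.sum_sub_distrib]; simp
  have hMi : Integrable M := by
    obtain ⟨C, hC, h⟩ := key 0
    simp only [Finset.range_zero, Finset.sum_empty, sub_zero] at h
    exact decay_integrable M hM.aestronglyMeasurable _ C h
  have hWsum : ∀ N, Integrable (fun η => ∑ n ∈ Finset.range N, 1 * W n η) := fun N =>
    integrable_finset_sum _ fun n _ => (hWi n).const_mul _
  have hR : ∀ N : ℕ, ContDiff ℝ N (fun ξ => 𝓕 M ξ - ((‖ξ‖ ^ (2 * e + 1) : ℝ) : ℂ) * ∑ n ∈ Finset.range N, P n ξ) := by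
    intro N
    obtain ⟨C, hC, h⟩ := key N
    have h1 := decay_contDiff (fun η => M η - ∑ n ∈ Finset.range N, 1 * W n η)
      (hMi.sub (hWsum N)).aestronglyMeasurable (2 * e + N) C h
    have h2 : ContDiff ℝ N (𝓕 (fun η => M η - ∑ n ∈ Finset.range N, 1 * W n η)) :=
      h1.of_le (by exact_mod_cast Nat.le_add_left _ _)
    have h3 : ContDiff ℝ N (fun ξ => ∑ n ∈ Finset.range N, S n ξ) := ContDiff.sum fun n _ => hS n N
    have h4 := h2.add h3
    have e : (fun ξ => 𝓕 M ξ - ((‖ξ‖ ^ (2 * e + 1) : ℝ) : ℂ) * ∑ n ∈ Finset.range N, P n ξ) =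
      fun ξ => 𝓕 (fun η => M η - ∑ n ∈ Finset.range N, 1 * W n η) ξ + ∑ n ∈ Finset.range N, S n ξ := by
      ext ξ
      rw [fourier_sub_lin _ _ hMi (hWsum N), fourier_sum_lin _ (fun _ => 1) W (fun n _ => hWi n)]
      simp only [one_mul, hF, Finset.sum_add_distrib, Finset.mul_sum]
      ring
    rw [e]; exact h4
  obtain ⟨C₁, hC₁, hB⟩ := borel_sum (2 * e + 1) P hP hhom hsm
  refine ⟨hMi, fun ξ => 𝓕 M ξ - C₁ ξ * ((‖ξ‖ ^ (2 * e + 1) : ℝ) : ℂ), C₁, fun N => ?_, hC₁, fun ξ => by ring⟩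
  have := (hR N).sub (hB N)
  have e : (fun ξ => 𝓕 M ξ - C₁ ξ * ((‖ξ‖ ^ (2 * e + 1) : ℝ) : ℂ)) = fun ξ =>
    (𝓕 M ξ - ((‖ξ‖ ^ (2 * e + 1) : ℝ) : ℂ) * ∑ n ∈ Finset.range N, P n ξ) -
      ((‖ξ‖ ^ (2 * e + 1) : ℝ) : ℂ) * (C₁ ξ - ∑ n ∈ Finset.range N, P n ξ) := by
    ext ξ; ring
  rw [e]; exact this

lemma haar_transport {E D : Type*} [NormedAddCommGroup E] [NormedSpace ℝ E] [FiniteDimensional ℝ E]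
    [MeasureSpace E] [BorelSpace E] [(volume : Measure E).IsAddHaarMeasure]
    [NormedAddCommGroup D] [NormedSpace ℝ D] [FiniteDimensional ℝ D]
    [MeasureSpace D] [BorelSpace D] [(volume : Measure D).IsAddHaarMeasure] (T : E ≃L[ℝ] D) :
    ∃ c : ℝ, ∀ F : D → ℂ, ∫ z, F z = (c : ℂ) * ∫ x, F (T x) := by
  have hh : (Measure.map T (volume : Measure E)).IsAddHaarMeasure := T.isAddHaarMeasure_map _
  obtain ⟨c, hc⟩ : ∃ c : NNReal, (volume : Measure D) = c • Measure.map T (volume : Measure E) :=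
    ⟨_, Measure.isAddLeftInvariant_eq_smul _ _⟩
  refine ⟨c, fun F => ?_⟩
  have h2 : ∫ y, F y ∂(Measure.map T (volume : Measure E)) = ∫ x, F (T x) :=
    T.toHomeomorph.measurableEmbedding.integral_map F
  rw [hc, integral_smul_nnreal_measure, h2]
  rfl

/-- Taylor remainder of the unitary exponential. -/
lemma exp_taylor (N : ℕ) : ∃ K : ℝ, 0 ≤ K ∧ ∀ x : ℝ,
    ‖Complex.exp (x * Complex.I) - ∑ m ∈ Finset.range N, (x * Complex.I) ^ m / (m.factorial : ℂ)‖ ≤ K * |x| ^ N := by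
  rcases Nat.eq_zero_or_pos N with rfl | hN
  · refine ⟨1, zero_le_one, fun x => ?_⟩
    simp [Complex.norm_exp_ofReal_mul_I]
  refine ⟨(N.succ * ((N.factorial : ℝ) * N)⁻¹) + (1 + N), by positivity, fun x => ?_⟩
  have hx : ‖(x:ℂ) * Complex.I‖ = |x| := by simp
  rcases le_total |x| 1 with h | h
  · have := Complex.exp_bound (x := x * Complex.I) (by rw [hx]; exact h) hN
    rw [hx] at this
    refine this.trans ?_
    rw [mul_comm]
    gcongr
    have : (0:ℝ) ≤ 1 + N := by positivity
    linarith
  · have h1 : ‖∑ m ∈ Finset.range N, (x * Complex.I) ^ m / (m.factorial : ℂ)‖ ≤ ∑ m ∈ Finset.range N, |x| ^ N := by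
      refine norm_sum_le_of_le _ fun m hm => ?_
      rw [norm_div, norm_pow, hx, Complex.norm_natCast]
      have h2 : |x| ^ m ≤ |x| ^ N := pow_le_pow_right₀ h (Finset.mem_range.1 hm).le
      have h3 : (1:ℝ) ≤ m.factorial := by exact_mod_cast Nat.succ_le_of_lt m.factorial_pos
      exact (div_le_self (by positivity) h3).trans h2
    rw [Finset.sum_const, Finset.card_range, nsmul_eq_mul] at h1
    refine (norm_sub_le _ _).trans ?_
    rw [Complex.norm_exp_ofReal_mul_I, add_mul]
    have h4 : 1 ≤ |x| ^ N := one_le_pow₀ h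
    have h5 : 0 ≤ (N.succ * ((N.factorial : ℝ) * N)⁻¹) * |x| ^ N := by positivity
    nlinarith

abbrev EE (d : ℕ) := EuclideanSpace ℂ (Fin d)

def qq {d : ℕ} (x : EE d) : ℂ := ∑ j, (x j) ^ 2

lemma qq_norm_le {d : ℕ} (x : EE d) : ‖qq x‖ ≤ ‖x‖ ^ 2 := by
  rw [EuclideanSpace.norm_sq_eq]
  refine norm_sum_le_of_le _ fun j _ => ?_
  rw [norm_pow]

lemma qq_continuous {d : ℕ} : Continuous (qq : EE d → ℂ) := by
  unfold qq; fun_prop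

lemma qq_smul {d : ℕ} (σ : ℂ) (x : EE d) : qq (σ • x) = σ ^ 2 * qq x := by
  simp only [qq, PiLp.smul_apply, smul_eq_mul, mul_pow, Finset.mul_sum]

/-- one-variable complex Gaussian integral -/
lemma gauss_one (b b' : ℂ) (hb : 0 < b.re) (hb' : 0 < b'.re) (w : ℂ) :
    ∫ z : ℂ, Complex.exp (-(2 * Real.pi * Complex.I) * ((inner ℝ z w : ℝ) : ℂ)) *
      Complex.exp (-b * (z.re : ℂ) ^ 2 - b' * (z.im : ℂ) ^ 2) =
    ((Real.pi / b) ^ (1 / 2 : ℂ) * (Real.pi / b') ^ (1 / 2 : ℂ)) *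
      Complex.exp (-(Real.pi : ℂ) ^ 2 * (w.re : ℂ) ^ 2 / b - (Real.pi : ℂ) ^ 2 * (w.im : ℂ) ^ 2 / b') := by
  have h1 := fourierIntegral_gaussian hb (-(2 * Real.pi * w.re))
  have h2 := fourierIntegral_gaussian hb' (-(2 * Real.pi * w.im))
  rw [← Complex.volume_preserving_equiv_real_prod.symm.integral_comp
    Complex.measurableEquivRealProd.symm.measurableEmbedding]
  have e : ∀ p : ℝ × ℝ, Complex.exp (-(2 * Real.pi * Complex.I) *
      ((inner ℝ (Complex.measurableEquivRealProd.symm p) w : ℝ) : ℂ)) *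
      Complex.exp (-b * ((Complex.measurableEquivRealProd.symm p).re : ℂ) ^ 2
        - b' * ((Complex.measurableEquivRealProd.symm p).im : ℂ) ^ 2) =
      (Complex.exp (Complex.I * (-(2 * Real.pi * w.re)) * (p.1:ℂ)) * Complex.exp (-b * (p.1:ℂ) ^ 2)) *
      (Complex.exp (Complex.I * (-(2 * Real.pi * w.im)) * (p.2:ℂ)) * Complex.exp (-b' * (p.2:ℂ) ^ 2)) := by
    intro p
    rw [← Complex.exp_add, ← Complex.exp_add, ← Complex.exp_add, ← Complex.exp_add]
    congr 1
    have : (inner ℝ (Complex.measurableEquivRealProd.symm p) w : ℝ) = p.1 * w.re + p.2 * w.im := by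
      simp [Complex.inner, Complex.measurableEquivRealProd]
      ring
    rw [this]
    simp [Complex.measurableEquivRealProd]
    ring
  simp_rw [e]
  rw [Measure.volume_eq_prod, integral_prod_mul
    (fun x : ℝ => Complex.exp (Complex.I * (-(2 * Real.pi * w.re)) * (x:ℂ)) * Complex.exp (-b * (x:ℂ) ^ 2))
    (fun x : ℝ => Complex.exp (Complex.I * (-(2 * Real.pi * w.im)) * (x:ℂ)) * Complex.exp (-b' * (x:ℂ) ^ 2)),
    h1, h2, mul_mul_mul_comm, ← Complex.exp_add]
  congr 2
  have hb0 : b ≠ 0 := by rintro rfl; simp at hb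
  have hb0' : b' ≠ 0 := by rintro rfl; simp at hb'
  field_simp
  ring

open FourierTransform in
lemma gauss_E (d : ℕ) : ∃ c : ℝ, ∀ b b' : ℂ, 0 < b.re → 0 < b'.re → ∀ w : EE d,
    𝓕 (fun x : EE d => ∏ j, Complex.exp (-b * ((x j).re : ℂ) ^ 2 - b' * ((x j).im : ℂ) ^ 2)) w =
    c * (((Real.pi / b) ^ (1 / 2 : ℂ) * (Real.pi / b') ^ (1 / 2 : ℂ)) ^ d *
      ∏ j, Complex.exp (-(Real.pi : ℂ) ^ 2 * ((w j).re : ℂ) ^ 2 / b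
        - (Real.pi : ℂ) ^ 2 * ((w j).im : ℂ) ^ 2 / b')) := by
  obtain ⟨c, hc⟩ := haar_transport (PiLp.continuousLinearEquiv 2 ℝ (fun _ : Fin d => ℂ)).symm
  refine ⟨c, fun b b' hb hb' w => ?_⟩
  rw [Real.fourier_eq, hc]
  congr 1
  have e : ∀ z : Fin d → ℂ, Real.fourierChar (-(inner ℝ ((PiLp.continuousLinearEquiv 2 ℝ (fun _ : Fin d => ℂ)).symm z) w : ℝ)) •
      (∏ j, Complex.exp (-b * ((((PiLp.continuousLinearEquiv 2 ℝ (fun _ : Fin d => ℂ)).symm z) j).re : ℂ) ^ 2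
        - b' * ((((PiLp.continuousLinearEquiv 2 ℝ (fun _ : Fin d => ℂ)).symm z) j).im : ℂ) ^ 2)) =
      ∏ j, (Complex.exp (-(2 * Real.pi * Complex.I) * ((inner ℝ (z j) (w j) : ℝ) : ℂ)) *
      Complex.exp (-b * ((z j).re : ℂ) ^ 2 - b' * ((z j).im : ℂ) ^ 2)) := by
    intro z
    rw [Finset.prod_mul_distrib, Circle.smul_def, smul_eq_mul, Real.fourierChar_apply,
      PiLp.inner_apply]
    congr 1
    rw [← Complex.exp_sum]
    congr 1
    push_cast
    rw [← Finset.mul_sum]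
    simp
    ring
  simp_rw [e]
  rw [integral_fintype_prod_volume_eq_prod (fun j (z : ℂ) =>
    (Complex.exp (-(2 * Real.pi * Complex.I) * ((inner ℝ z (w j) : ℝ) : ℂ)) *
      Complex.exp (-b * (z.re : ℂ) ^ 2 - b' * (z.im : ℂ) ^ 2)))]
  simp_rw [gauss_one b b' hb hb']
  rw [Finset.prod_mul_distrib, Finset.prod_const, Finset.card_univ, Fintype.card_fin]

lemma gauss_E_form {d : ℕ} (ε : ℝ) (x : EE d) :
    ∏ j, Complex.exp (-(Real.pi * (ε - Complex.I)) * ((x j).re : ℂ) ^ 2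
      - (Real.pi * (ε + Complex.I)) * ((x j).im : ℂ) ^ 2) =
    Complex.exp (((-(Real.pi * ε) * ‖x‖ ^ 2 : ℝ) : ℂ) + ((Real.pi * (qq x).re : ℝ) : ℂ) * Complex.I) := by
  rw [← Complex.exp_sum, EuclideanSpace.norm_sq_eq, qq, Complex.re_sum]
  congr 1
  push_cast
  rw [Finset.mul_sum, Finset.mul_sum, Finset.sum_mul, ← Finset.sum_add_distrib]
  apply Finset.sum_congr rfl
  intro j _
  have : ((‖x j‖ : ℂ)) ^ 2 = (x j).re ^ 2 + (x j).im ^ 2 := by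
    have := Complex.sq_norm (x j)
    rw [Complex.normSq_apply] at this
    rw [← Complex.ofReal_pow, this]; push_cast; ring
  rw [this]
  have : ((x j) ^ 2).re = (x j).re ^ 2 - (x j).im ^ 2 := by
    rw [pow_two, Complex.mul_re]; ring
  rw [this]; push_cast; ring

open FourierTransform Topology in
lemma weil (d : ℕ) : ∃ c : ℂ, ∀ φ : SchwartzMap (EE d) ℂ,
    ∫ x, Complex.exp (((Real.pi * (qq x).re : ℝ) : ℂ) * Complex.I) * 𝓕 (φ : EE d → ℂ) x =
    c * ∫ w, Complex.exp (((-Real.pi * (qq w).re : ℝ) : ℂ) * Complex.I) * φ w := by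
  have hpi := Real.pi_pos
  have hpi' : (Real.pi : ℂ) ≠ 0 := by exact_mod_cast hpi.ne'
  obtain ⟨c, hc⟩ := gauss_E d
  let A : ℝ → ℂ := fun ε => ((Real.pi / (Real.pi * (ε - Complex.I))) ^ (1 / 2 : ℂ) *
    (Real.pi / (Real.pi * (ε + Complex.I))) ^ (1 / 2 : ℂ)) ^ d
  refine ⟨c * A 0, fun φ => ?_⟩
  let G : ℝ → EE d → ℂ := fun ε x =>
    Complex.exp (((-(Real.pi * ε) * ‖x‖ ^ 2 : ℝ) : ℂ) + ((Real.pi * (qq x).re : ℝ) : ℂ) * Complex.I)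
  let H : ℝ → EE d → ℂ := fun ε w => ∏ j, Complex.exp (-(Real.pi : ℂ) ^ 2 * ((w j).re : ℂ) ^ 2 / (Real.pi * (ε - Complex.I))
        - (Real.pi : ℂ) ^ 2 * ((w j).im : ℂ) ^ 2 / (Real.pi * (ε + Complex.I)))
  have hGc : ∀ ε, Continuous (G ε) := fun ε => by
    have := qq_continuous (d := d)
    simp only [G]; fun_prop
  have hHc : ∀ ε, Continuous (H ε) := fun ε => by
    simp only [H]; fun_prop
  have hGn : ∀ ε x, ‖G ε x‖ = Real.exp (-(Real.pi * ε) * ‖x‖ ^ 2) := by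
    intro ε x
    simp only [G, Complex.norm_exp]
    congr 1
    simp only [Complex.add_re, Complex.ofReal_re, Complex.mul_re, Complex.I_re, Complex.I_im, Complex.ofReal_im]
    ring
  have hGi : ∀ ε, 0 < ε → Integrable (G ε) := by
    intro ε hε
    have := GaussianFourier.integrable_cexp_neg_mul_sq_norm_add (V := EE d) (b := ((Real.pi * ε : ℝ) : ℂ))
      (by rw [Complex.ofReal_re]; positivity) 0 0
    refine this.mono (hGc ε).aestronglyMeasurable (Eventually.of_forall fun x => ?_)
    rw [hGn, Complex.norm_exp]
    apply le_of_eq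
    congr 1
    rw [← Complex.ofReal_neg, ← Complex.ofReal_pow, ← Complex.ofReal_mul, zero_mul, add_zero, Complex.ofReal_re]
  have hφi : Integrable φ := φ.integrable
  have hFφ : Integrable (𝓕 (φ : EE d → ℂ)) := by
    rw [← SchwartzMap.fourier_coe]
    exact (𝓕 φ).integrable
  have hmain : ∀ ε, 0 < ε → ∫ x, G ε x * 𝓕 (φ : EE d → ℂ) x = c * A ε * ∫ w, H ε w * φ w := by
    intro ε hε
    have h1 := VectorFourier.integral_fourierIntegral_smul_eq_flip (L := innerₗ (EE d)) (μ := volume) (ν := volume)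
      Real.continuous_fourierChar continuous_inner (hGi ε hε) hφi
    have h2 : ∀ w, 𝓕 (G ε) w = c * A ε * H ε w := by
      intro w
      have := hc (Real.pi * (ε - Complex.I)) (Real.pi * (ε + Complex.I)) (by
        rw [Complex.re_ofReal_mul]; simp; positivity) (by
        rw [Complex.re_ofReal_mul]; simp; positivity) w
      simp_rw [gauss_E_form] at this
      change 𝓕 (G ε) w = _ at this
      rw [this]; simp only [A, H]; ring
    have h3 : ∫ ξ, 𝓕 (G ε) ξ • φ ξ = ∫ x, G ε x • 𝓕 (φ : EE d → ℂ) x := by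
      simpa using! h1
    simp only [smul_eq_mul] at h3
    rw [← h3, ← integral_const_mul]
    congr 1; ext w; rw [h2]; ring
  have hl1 : Tendsto (fun ε => ∫ x, G ε x * 𝓕 (φ : EE d → ℂ) x) (𝓝[>] 0)
      (𝓝 (∫ x, G 0 x * 𝓕 (φ : EE d → ℂ) x)) := by
    apply tendsto_integral_filter_of_dominated_convergence (fun x => ‖𝓕 (φ : EE d → ℂ) x‖)
    · exact Eventually.of_forall fun ε => (hGc ε).aestronglyMeasurable.mul hFφ.aestronglyMeasurable
    · filter_upwards [self_mem_nhdsWithin] with ε hε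
      refine Eventually.of_forall fun x => ?_
      have hε' : (0:ℝ) < ε := hε
      rw [norm_mul, hGn]
      apply mul_le_of_le_one_left (norm_nonneg _)
      rw [Real.exp_le_one_iff]
      have : 0 ≤ Real.pi * ε * ‖x‖ ^ 2 := by positivity
      linarith
    · exact hFφ.norm
    · refine Eventually.of_forall fun x => ?_
      have : Continuous (fun ε => G ε x * 𝓕 (φ : EE d → ℂ) x) := by simp only [G]; fun_prop
      exact (this.tendsto 0).mono_left nhdsWithin_le_nhds
  have hne1 : ∀ ε : ℝ, (Real.pi : ℂ) * (ε - Complex.I) ≠ 0 := by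
    intro ε h
    rcases mul_eq_zero.1 h with h | h
    · exact hpi' h
    · have := congrArg Complex.im h; simp at this
  have hne2 : ∀ ε : ℝ, (Real.pi : ℂ) * (ε + Complex.I) ≠ 0 := by
    intro ε h
    rcases mul_eq_zero.1 h with h | h
    · exact hpi' h
    · have := congrArg Complex.im h; simp at this
  have hA : ContinuousAt A 0 := by
    simp only [A]
    refine ContinuousAt.pow (ContinuousAt.mul (ContinuousAt.cpow ?_ continuousAt_const ?_)
      (ContinuousAt.cpow ?_ continuousAt_const ?_)) d
    · exact ContinuousAt.div continuousAt_const (by fun_prop) (hne1 0)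
    · right
      have : (Real.pi / (Real.pi * (((0:ℝ):ℂ) - Complex.I)) : ℂ) = Complex.I := by
        rw [Complex.ofReal_zero, zero_sub]
        field_simp
        simp
      rw [this]; simp
    · exact ContinuousAt.div continuousAt_const (by fun_prop) (hne2 0)
    · right
      have : (Real.pi / (Real.pi * (((0:ℝ):ℂ) + Complex.I)) : ℂ) = -Complex.I := by
        rw [Complex.ofReal_zero, zero_add]
        field_simp
        simp
      rw [this]; simp
  have hl2 : Tendsto (fun ε => ∫ w, H ε w * φ w) (𝓝[>] 0) (𝓝 (∫ w, H 0 w * φ w)) := by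
    apply tendsto_integral_filter_of_dominated_convergence (fun x => ‖φ x‖)
    · exact Eventually.of_forall fun ε => (hHc ε).aestronglyMeasurable.mul hφi.aestronglyMeasurable
    · filter_upwards [self_mem_nhdsWithin] with ε hε
      refine Eventually.of_forall fun w => ?_
      have hε' : (0:ℝ) < ε := hε
      rw [norm_mul]
      apply mul_le_of_le_one_left (norm_nonneg _)
      simp only [H, norm_prod]
      apply Finset.prod_le_one
      · intros; positivity
      · intro j _
        rw [Complex.norm_exp, Real.exp_le_one_iff]
        have e1 : -(Real.pi : ℂ) ^ 2 * ((w j).re : ℂ) ^ 2 / (Real.pi * (ε - Complex.I))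
          - (Real.pi : ℂ) ^ 2 * ((w j).im : ℂ) ^ 2 / (Real.pi * (ε + Complex.I)) =
          ((-(Real.pi * (w j).re ^ 2) : ℝ) : ℂ) * (ε - Complex.I)⁻¹ + ((-(Real.pi * (w j).im ^ 2) : ℝ) : ℂ) * (ε + Complex.I)⁻¹ := by
          have h1 : ((ε:ℂ) - Complex.I) ≠ 0 := right_ne_zero_of_mul (hne1 ε)
          have h2 : ((ε:ℂ) + Complex.I) ≠ 0 := right_ne_zero_of_mul (hne2 ε)
          push_cast
          field_simp
          ring
        rw [e1, Complex.add_re, Complex.re_ofReal_mul, Complex.re_ofReal_mul, Complex.inv_re, Complex.inv_re]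
        simp only [Complex.sub_re, Complex.add_re, Complex.ofReal_re, Complex.I_re, sub_zero, add_zero]
        have h1 : 0 ≤ ε / Complex.normSq (ε - Complex.I) := div_nonneg hε'.le (Complex.normSq_nonneg _)
        have h2 : 0 ≤ ε / Complex.normSq (ε + Complex.I) := div_nonneg hε'.le (Complex.normSq_nonneg _)
        have h3 : 0 ≤ Real.pi * (w j).re ^ 2 := by positivity
        have h4 : 0 ≤ Real.pi * (w j).im ^ 2 := by positivity
        have h5 := mul_nonneg h3 h1
        have h6 := mul_nonneg h4 h2
        linarith
    · exact hφi.norm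
    · refine Eventually.of_forall fun w => ?_
      have : ContinuousAt (fun ε => H ε w * φ w) 0 := by
        refine ContinuousAt.mul ?_ continuousAt_const
        simp only [H]
        refine tendsto_finsetProd _ fun j _ => ?_
        refine (Complex.continuous_exp.continuousAt (x := _)).tendsto.comp ?_
        refine Tendsto.sub ?_ ?_
        · exact ContinuousAt.div continuousAt_const (by fun_prop) (hne1 0)
        · exact ContinuousAt.div continuousAt_const (by fun_prop) (hne2 0)
      exact this.tendsto.mono_left nhdsWithin_le_nhds
  have hl3 := ((tendsto_const_nhds (x := (c:ℂ))).mul (hA.tendsto.mono_left nhdsWithin_le_nhds)).mul hl2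
  have hfin := tendsto_nhds_unique_of_eventuallyEq hl1 hl3 (by
    filter_upwards [self_mem_nhdsWithin] with ε hε
    exact hmain ε hε)
  have eG : ∀ x, G 0 x = Complex.exp (((Real.pi * (qq x).re : ℝ) : ℂ) * Complex.I) := by
    intro x; simp [G]
  have eH : ∀ w, H 0 w = Complex.exp (((-Real.pi * (qq w).re : ℝ) : ℂ) * Complex.I) := by
    intro w
    have hh : H 0 w = ∏ j, Complex.exp ((Real.pi * Complex.I) * ((w j).im ^ 2 - (w j).re ^ 2)) := by
      simp only [H]
      apply Finset.prod_congr rfl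
      intro j _
      congr 1
      have hI := Complex.I_ne_zero
      have hII := Complex.I_sq
      rw [Complex.ofReal_zero, zero_sub, zero_add]
      field_simp
      rw [hII]; ring
    rw [hh, ← Complex.exp_sum, qq, Complex.re_sum]
    congr 1
    push_cast
    rw [Finset.mul_sum, Finset.sum_mul]
    apply Finset.sum_congr rfl
    intro j _
    have : ((w j) ^ 2).re = (w j).re ^ 2 - (w j).im ^ 2 := by
      rw [pow_two, Complex.mul_re]; ring
    rw [this]; push_cast; ring
  simp_rw [eG, eH] at hfin
  exact hfin

def csmulE (d : ℕ) (σ : ℂ) (h : σ ≠ 0) : EE d ≃L[ℝ] EE d :=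
  ((LinearEquiv.smulOfNeZero ℂ (EE d) σ h).restrictScalars ℝ).toContinuousLinearEquiv

lemma csmulE_apply (d : ℕ) (σ : ℂ) (h : σ ≠ 0) (x : EE d) : csmulE d σ h x = σ • x := rfl

lemma csmul_integral {d : ℕ} (σ : ℂ) (h : σ ≠ 0) (F : EE d → ℂ) :
    ∫ x, F (σ • x) = ((‖σ‖ ^ (2 * d) : ℝ) : ℂ)⁻¹ * ∫ x, F x := by
  have hn : (0:ℝ) < ‖σ‖ := norm_pos_iff.2 h
  let u : ℂ := σ / ‖σ‖
  have hu1 : ‖u‖ = 1 := by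
    simp only [u, norm_div, Complex.norm_real, norm_norm]; field_simp
  have hu0 : u ≠ 0 := by rw [← norm_ne_zero_iff, hu1]; exact one_ne_zero
  let U : EE d ≃ₗᵢ[ℝ] EE d := LinearIsometryEquiv.mk
    ((LinearEquiv.smulOfNeZero ℂ (EE d) u hu0).restrictScalars ℝ) (fun x => by
      change ‖u • x‖ = ‖x‖
      rw [norm_smul, hu1, one_mul])
  have hU : ∀ x, U x = u • x := fun x => rfl
  have e : ∀ x : EE d, σ • x = ‖σ‖ • U x := by
    intro x
    rw [hU, ← Complex.coe_smul, smul_smul]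
    congr 1
    simp only [u]
    have : (‖σ‖ : ℂ) ≠ 0 := by exact_mod_cast hn.ne'
    field_simp
  simp_rw [e]
  have h1 := U.measurePreserving.integral_comp U.toHomeomorph.measurableEmbedding (fun x => F (‖σ‖ • x))
  rw [h1, Measure.integral_comp_smul]
  have hf : Module.finrank ℝ (EE d) = 2 * d := by
    rw [finrank_real_of_complex, finrank_euclideanSpace, Fintype.card_fin]
  rw [hf, abs_of_nonneg (by positivity), Complex.real_smul]
  push_cast; rfl

def MM {d : ℕ} (Ψ : EE d → ℂ) (η : ℂ) : ℂ :=
  ∫ x, Complex.exp (((2 * Real.pi * (inner ℝ η (qq x)) : ℝ) : ℂ) * Complex.I) * Ψ x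

open FourierTransform in
lemma MM_scaled (d : ℕ) : ∃ c : ℂ, ∀ (φ : SchwartzMap (EE d) ℂ) (η : ℂ), η ≠ 0 →
    MM (𝓕 (φ : EE d → ℂ)) η = c * ((‖η‖ ^ d : ℝ) : ℂ)⁻¹ *
      ∫ w, Complex.exp (((-(Real.pi / (2 * ‖η‖ ^ 2)) * (inner ℝ η (qq w)) : ℝ) : ℂ) * Complex.I) * φ w := by
  obtain ⟨c, hc⟩ := weil d
  refine ⟨c * (2 ^ d)⁻¹, fun φ η hη => ?_⟩
  obtain ⟨σ, hσ⟩ := IsAlgClosed.exists_pow_nat_eq (2 * (starRingEnd ℂ) η) (n := 2) (by norm_num)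
  have hη' : (starRingEnd ℂ) η ≠ 0 := by simpa using hη
  have hσ0 : σ ≠ 0 := by
    rintro rfl
    simp at hσ
    exact hη hσ
  have hnη : 0 < ‖η‖ := norm_pos_iff.2 hη
  let τ : ℂ := (starRingEnd ℂ) σ
  have hτ0 : τ ≠ 0 := by simpa [τ] using hσ0
  have hτ2 : τ ^ 2 = 2 * η := by
    simp only [τ]; rw [← map_pow, hσ, map_mul, Complex.conj_conj, Complex.conj_ofNat]
  have hτn : ‖τ‖ = ‖σ‖ := by simp [τ]
  have hσn : ‖σ‖ ^ 2 = 2 * ‖η‖ := by rw [← norm_pow, hσ]; simp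
  let k : ℂ := ((‖σ‖ ^ (2 * d) : ℝ) : ℂ)⁻¹
  have hk0 : k ≠ 0 := by
    simp only [k]
    apply inv_ne_zero
    have : ‖σ‖ ^ (2 * d) ≠ 0 := pow_ne_zero _ (norm_ne_zero_iff.2 hσ0)
    exact_mod_cast this
  have hk : k = (2 ^ d)⁻¹ * ((‖η‖ ^ d : ℝ) : ℂ)⁻¹ := by
    simp only [k]; rw [pow_mul, hσn, mul_pow]; push_cast; rw [mul_inv]
  let φτ : SchwartzMap (EE d) ℂ := SchwartzMap.compCLMOfContinuousLinearEquiv ℂ (csmulE d τ hτ0) φ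
  have hφτ : ∀ x, φτ x = φ (τ • x) := fun x => rfl
  have hinner : ∀ x y : EE d, (inner ℝ (τ⁻¹ • x) y : ℝ) = inner ℝ x (σ⁻¹ • y) := by
    intro x y
    rw [PiLp.inner_apply, PiLp.inner_apply]
    apply Finset.sum_congr rfl
    intro j _
    simp only [PiLp.smul_apply, smul_eq_mul, Complex.inner, map_mul, map_inv₀, τ, Complex.conj_conj]
    congr 1; ring
  have hF : ∀ y, 𝓕 (φτ : EE d → ℂ) y = k * 𝓕 (φ : EE d → ℂ) (σ⁻¹ • y) := by
    intro y
    rw [Real.fourier_eq, Real.fourier_eq]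
    have := csmul_integral τ hτ0 (fun x : EE d => Real.fourierChar (-(inner ℝ (τ⁻¹ • x) y : ℝ)) • φ x)
    rw [hτn] at this
    simp only [smul_smul, inv_mul_cancel₀ hτ0, one_smul] at this
    simp only [hinner] at this
    simp only [hφτ]
    exact this
  have h1 := hc φτ
  simp only [hF, hφτ] at h1
  have h2 := csmul_integral σ⁻¹ (inv_ne_zero hσ0) (fun y : EE d =>
    Complex.exp (((Real.pi * (qq (σ • y)).re : ℝ) : ℂ) * Complex.I) * 𝓕 (φ : EE d → ℂ) y)
  simp only [smul_smul, mul_inv_cancel₀ hσ0, one_smul] at h2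
  have hk' : ((‖σ⁻¹‖ ^ (2 * d) : ℝ) : ℂ)⁻¹ = k⁻¹ := by
    simp only [k, norm_inv, inv_pow]; push_cast; rfl
  rw [hk'] at h2
  have h3 := csmul_integral τ hτ0 (fun w : EE d =>
    Complex.exp (((-Real.pi * (qq (τ⁻¹ • w)).re : ℝ) : ℂ) * Complex.I) * φ w)
  simp only [smul_smul, inv_mul_cancel₀ hτ0, one_smul] at h3
  rw [hτn] at h3
  change _ = k * _ at h3
  have h4 : ∫ x, Complex.exp (((Real.pi * (qq x).re : ℝ) : ℂ) * Complex.I) * (k * 𝓕 (φ : EE d → ℂ) (σ⁻¹ • x))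
      = k * ∫ x, Complex.exp (((Real.pi * (qq x).re : ℝ) : ℂ) * Complex.I) * (𝓕 (φ : EE d → ℂ) (σ⁻¹ • x)) := by
    rw [← integral_const_mul]; congr 1; ext x; ring
  rw [h4, h2, ← mul_assoc, mul_inv_cancel₀ hk0, one_mul, h3] at h1
  have e1 : ∀ y : EE d, Real.pi * (qq (σ • y)).re = 2 * Real.pi * inner ℝ η (qq y) := by
    intro y
    rw [qq_smul, hσ, Complex.inner, mul_assoc, ← Complex.ofReal_ofNat, Complex.re_ofReal_mul]; ring_nf
  have e2 : ∀ w : EE d, -Real.pi * (qq (τ⁻¹ • w)).re = -(Real.pi / (2 * ‖η‖ ^ 2)) * inner ℝ η (qq w) := by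
    intro w
    have : (τ⁻¹) ^ 2 * qq w = (((2 * ‖η‖ ^ 2)⁻¹ : ℝ) : ℂ) * ((starRingEnd ℂ) η * qq w) := by
      rw [inv_pow, hτ2]
      have hh := Complex.mul_conj' η
      push_cast
      rw [← hh]
      field_simp
    rw [qq_smul, this, Complex.re_ofReal_mul, Complex.inner]
    rw [mul_comm (starRingEnd ℂ η)]
    ring
  simp_rw [e1, e2] at h1
  rw [MM, h1, hk]
  ring

lemma qmom_integrable {d : ℕ} (φ : SchwartzMap (EE d) ℂ) (h : EE d → ℂ) (hc : Continuous h) (m : ℕ) (K : ℝ)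
    (hb : ∀ w, ‖h w‖ ≤ K * (‖w‖ ^ 2) ^ m) : Integrable (fun w => h w * φ w) := by
  have := (φ.integrable_pow_mul volume (2 * m)).const_mul K
  refine this.mono' (hc.mul φ.continuous).aestronglyMeasurable (Eventually.of_forall fun w => ?_)
  rw [norm_mul, ← mul_assoc, pow_mul]
  gcongr
  exact hb w

lemma pow_re_im_bound (z : ℂ) (j k : ℕ) : ‖((z.re ^ j * z.im ^ k : ℝ) : ℂ)‖ ≤ ‖z‖ ^ (j + k) := by
  rw [Complex.norm_real, Real.norm_eq_abs, abs_mul, abs_pow, abs_pow, pow_add]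
  gcongr
  · exact Complex.abs_re_le_norm z
  · exact Complex.abs_im_le_norm z

open FourierTransform in
lemma MM_asymp {d : ℕ} (φ : SchwartzMap (EE d) ℂ) : ∃ p : ℕ → ℕ → ℂ, ∀ N : ℕ, ∃ C : ℝ, 0 ≤ C ∧
    ∀ η : ℂ, 1 ≤ ‖η‖ →
      ‖MM (𝓕 (φ : EE d → ℂ)) η - ∑ n ∈ Finset.range N, ((‖η‖ ^ (d + 2 * n) : ℝ) : ℂ)⁻¹ *
        (∑ j ∈ Finset.range (n + 1), p n j * ((η.re ^ j * η.im ^ (n - j) : ℝ) : ℂ))‖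
        ≤ C * (‖η‖ ^ (d + N))⁻¹ := by
  obtain ⟨c, hc⟩ := MM_scaled d
  have hpi := Real.pi_pos
  let a : ℂ := ((-(Real.pi / 2) : ℝ) : ℂ) * Complex.I
  refine ⟨fun n j => c * (a ^ n / (n.factorial : ℂ) * ((n.choose j : ℂ) *
    ∫ w, (((qq w).re ^ j * (qq w).im ^ (n - j) : ℝ) : ℂ) * φ w)), fun N => ?_⟩
  obtain ⟨K, hK, hT⟩ := exp_taylor N
  have hqc := qq_continuous (d := d)
  have hInt0 := (φ.integrable_pow_mul volume (2 * N))
  refine ⟨‖c‖ * (K * (Real.pi / 2) ^ N * ∫ w, ‖w‖ ^ (2 * N) * ‖φ w‖), by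
    have : 0 ≤ ∫ w, ‖w‖ ^ (2 * N) * ‖φ w‖ := integral_nonneg fun w => by positivity
    positivity, fun η hη => ?_⟩
  have hn : 0 < ‖η‖ := by linarith
  have hη0 : η ≠ 0 := norm_pos_iff.1 hn
  have hn' : (‖η‖ : ℂ) ≠ 0 := by exact_mod_cast hn.ne'
  let X : EE d → ℝ := fun w => -(Real.pi / (2 * ‖η‖ ^ 2)) * (inner ℝ η (qq w))
  have hXc : Continuous X := by simp only [X]; fun_prop
  have hXb : ∀ w, |X w| ≤ (Real.pi / 2) * ‖η‖⁻¹ * ‖w‖ ^ 2 := by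
    intro w
    simp only [X]
    rw [abs_mul, abs_neg, abs_of_nonneg (by positivity)]
    calc _ ≤ (Real.pi / (2 * ‖η‖ ^ 2)) * (‖η‖ * ‖w‖ ^ 2) := by
          gcongr
          exact (abs_real_inner_le_norm _ _).trans (by gcongr; exact qq_norm_le w)
      _ = _ := by field_simp
  have hmono : ∀ n j, j ∈ Finset.range (n + 1) →
      Integrable (fun w => (((qq w).re ^ j * (qq w).im ^ (n - j) : ℝ) : ℂ) * φ w) := by
    intro n j hj
    refine qmom_integrable φ _ (by fun_prop) n 1 fun w => ?_
    rw [one_mul]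
    refine (pow_re_im_bound _ _ _).trans ?_
    rw [show j + (n - j) = n by have := Finset.mem_range.1 hj; omega]
    gcongr
    exact qq_norm_le w
  have hterm : ∀ n w, ((X w : ℂ) * Complex.I) ^ n / (n.factorial : ℂ) * φ w =
      (a ^ n / (n.factorial : ℂ) * ((‖η‖ ^ (2 * n) : ℝ) : ℂ)⁻¹) * ∑ j ∈ Finset.range (n + 1),
        ((η.re ^ j * η.im ^ (n - j) : ℝ) : ℂ) * (n.choose j : ℂ) *
        ((((qq w).re ^ j * (qq w).im ^ (n - j) : ℝ) : ℂ) * φ w) := by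
    intro n w
    have hi : (inner ℝ η (qq w) : ℝ) = η.re * (qq w).re + η.im * (qq w).im := by
      rw [Complex.inner]; simp; ring
    have : ((X w : ℂ) * Complex.I) = a * ((‖η‖ ^ 2 : ℝ) : ℂ)⁻¹ * (((η.re * (qq w).re + η.im * (qq w).im : ℝ)) : ℂ) := by
      simp only [X, a, hi]; push_cast; field_simp
    rw [this, mul_pow, mul_pow, ← Complex.ofReal_pow (_ + _), add_pow, pow_mul]
    push_cast
    rw [inv_pow, Finset.mul_sum, Finset.sum_div, Finset.sum_mul, Finset.mul_sum]
    apply Finset.sum_congr rfl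
    intro j _
    rw [mul_pow, mul_pow]; ring
  have hti : ∀ n, Integrable (fun w => ((X w : ℂ) * Complex.I) ^ n / (n.factorial : ℂ) * φ w) := by
    intro n
    simp_rw [hterm]
    refine Integrable.const_mul (integrable_finsetSum _ fun j hj => (hmono n j hj).const_mul _) _
  have htint : ∀ n, ∫ w, ((X w : ℂ) * Complex.I) ^ n / (n.factorial : ℂ) * φ w =
      (a ^ n / (n.factorial : ℂ) * ((‖η‖ ^ (2 * n) : ℝ) : ℂ)⁻¹) * ∑ j ∈ Finset.range (n + 1),
        ((η.re ^ j * η.im ^ (n - j) : ℝ) : ℂ) * (n.choose j : ℂ) *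
        ∫ w, ((((qq w).re ^ j * (qq w).im ^ (n - j) : ℝ) : ℂ) * φ w) := by
    intro n
    simp_rw [hterm]
    rw [integral_const_mul, integral_finsetSum _ fun j hj => (hmono n j hj).const_mul _]
    simp_rw [integral_const_mul]
  have hexpi : Integrable (fun w => Complex.exp ((X w : ℂ) * Complex.I) * φ w) := by
    refine qmom_integrable φ _ (by fun_prop) 0 1 fun w => ?_
    rw [Complex.norm_exp_ofReal_mul_I]; simp
  have hsum : ∑ n ∈ Finset.range N, ((‖η‖ ^ (d + 2 * n) : ℝ) : ℂ)⁻¹ *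
        (∑ j ∈ Finset.range (n + 1), (c * (a ^ n / (n.factorial : ℂ) * ((n.choose j : ℂ) *
    ∫ w, (((qq w).re ^ j * (qq w).im ^ (n - j) : ℝ) : ℂ) * φ w))) * ((η.re ^ j * η.im ^ (n - j) : ℝ) : ℂ))
      = c * ((‖η‖ ^ d : ℝ) : ℂ)⁻¹ * ∑ n ∈ Finset.range N,
        ∫ w, ((X w : ℂ) * Complex.I) ^ n / (n.factorial : ℂ) * φ w := by
    rw [Finset.mul_sum]
    apply Finset.sum_congr rfl
    intro n _
    rw [htint, Finset.mul_sum, Finset.mul_sum, Finset.mul_sum]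
    apply Finset.sum_congr rfl
    intro j _
    rw [pow_add]; push_cast; rw [mul_inv]; ring
  rw [hc φ η hη0, hsum, ← integral_finsetSum _ fun n _ => hti n]
  change ‖c * ((‖η‖ ^ d : ℝ) : ℂ)⁻¹ * (∫ w, Complex.exp ((X w : ℂ) * Complex.I) * φ w) - _‖ ≤ _
  rw [← mul_sub, ← integral_sub hexpi (integrable_finsetSum _ fun n _ => hti n), norm_mul, norm_mul,
    norm_inv, Complex.norm_real, Real.norm_of_nonneg (by positivity)]
  have hfin : ‖∫ w, (Complex.exp ((X w : ℂ) * Complex.I) * φ w -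
      ∑ n ∈ Finset.range N, ((X w : ℂ) * Complex.I) ^ n / (n.factorial : ℂ) * φ w)‖ ≤
      ∫ w, (K * (Real.pi / 2) ^ N * (‖η‖ ^ N)⁻¹) * (‖w‖ ^ (2 * N) * ‖φ w‖) := by
    refine norm_integral_le_of_norm_le (hInt0.const_mul _) (Eventually.of_forall fun w => ?_)
    rw [← Finset.sum_mul, ← sub_mul, norm_mul]
    calc _ ≤ (K * |X w| ^ N) * ‖φ w‖ := by gcongr; exact hT _
      _ ≤ (K * ((Real.pi / 2) * ‖η‖⁻¹ * ‖w‖ ^ 2) ^ N) * ‖φ w‖ := by gcongr; exact hXb w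
      _ = _ := by rw [mul_pow, mul_pow, inv_pow, pow_mul]; ring
  rw [integral_const_mul] at hfin
  calc _ ≤ ‖c‖ * (‖η‖ ^ d)⁻¹ * ((K * (Real.pi / 2) ^ N * (‖η‖ ^ N)⁻¹) * ∫ w, (‖w‖ ^ (2 * N) * ‖φ w‖)) := by
        gcongr
    _ = _ := by rw [pow_add, mul_inv]; ring

lemma MM_continuous {d : ℕ} (Ψ : SchwartzMap (EE d) ℂ) : Continuous (MM (Ψ : EE d → ℂ)) := by
  unfold MM
  have hqc := qq_continuous (d := d)
  refine continuous_of_dominated (bound := fun x => ‖Ψ x‖) ?_ ?_ Ψ.integrable.norm ?_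
  · intro η
    exact (Continuous.mul (by fun_prop) Ψ.continuous).aestronglyMeasurable
  · intro η
    refine Eventually.of_forall fun x => ?_
    rw [norm_mul, Complex.norm_exp_ofReal_mul_I, one_mul]
  · refine Eventually.of_forall fun x => ?_
    fun_prop

open FourierTransform in
lemma pairing_smooth {d : ℕ} (Ψ : SchwartzMap (EE d) ℂ) (hM : Integrable (MM (Ψ : EE d → ℂ)))
    (g : ℂ → ℂ) (hg : ContDiff ℝ (⊤ : ℕ∞) g) (hc : HasCompactSupport g) :
    ∫ x, g (qq x) * Ψ x = ∫ ξ, g ξ * 𝓕 (MM (Ψ : EE d → ℂ)) ξ := by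
  have hqc := qq_continuous (d := d)
  let G : SchwartzMap ℂ ℂ := hc.toSchwartzMap hg
  have hGg : (G : ℂ → ℂ) = g := rfl
  have hgi : Integrable g := by rw [← hGg]; exact G.integrable
  have hFG : (𝓕 G : SchwartzMap ℂ ℂ) = 𝓕 g := by rw [SchwartzMap.fourier_coe, hGg]
  have hFi : Integrable (𝓕 g) := by rw [← hFG]; exact (𝓕 G).integrable
  have hFc : Continuous (𝓕 g) := by rw [← hFG]; exact (𝓕 G).continuous
  have hinv : ∀ ξ, g ξ = ∫ η, Complex.exp (((2 * Real.pi * (inner ℝ η ξ) : ℝ) : ℂ) * Complex.I) * 𝓕 g η := by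
    intro ξ
    have h1 : 𝓕⁻ (𝓕 g) = g :=
      Continuous.fourierInv_fourier_eq hg.continuous hgi hFi
    conv_lhs => rw [← h1]
    rw [Real.fourierInv_eq]
    refine integral_congr_ae (Eventually.of_forall fun η => ?_)
    simp only [Circle.smul_def, Real.fourierChar_apply, smul_eq_mul]
  have h3 : ∫ ξ, 𝓕 g ξ • MM (Ψ : EE d → ℂ) ξ = ∫ x, g x • 𝓕 (MM (Ψ : EE d → ℂ)) x := by
    simpa using! VectorFourier.integral_fourierIntegral_smul_eq_flip (L := innerₗ ℂ) (μ := volume) (ν := volume) Real.continuous_fourierChar continuous_inner hgi hM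
  simp only [smul_eq_mul] at h3
  rw [← h3]
  have e1 : ∫ x, g (qq x) * Ψ x = ∫ x, ∫ η, Complex.exp (((2 * Real.pi * (inner ℝ η (qq x)) : ℝ) : ℂ) * Complex.I) * (Ψ x * 𝓕 g η) := by
    refine integral_congr_ae (Eventually.of_forall fun x => ?_)
    simp only
    rw [hinv (qq x), ← integral_mul_const]
    refine integral_congr_ae (Eventually.of_forall fun η => ?_)
    simp only
    ring
  rw [e1, integral_integral_swap]
  · refine integral_congr_ae (Eventually.of_forall fun η => ?_)
    simp only [MM]
    rw [← integral_const_mul]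
    refine integral_congr_ae (Eventually.of_forall fun x => ?_)
    simp only
    ring
  · have h4 : Integrable (fun z : EE d × ℂ => Ψ z.1 * 𝓕 g z.2) (volume.prod volume) :=
      Ψ.integrable.mul_prod hFi
    have hΨc := Ψ.continuous
    refine h4.mono (Continuous.aestronglyMeasurable ?_) (Eventually.of_forall fun z => ?_)
    · unfold Function.uncurry
      fun_prop
    · simp only [Function.uncurry]
      rw [norm_mul, Complex.norm_exp_ofReal_mul_I, one_mul]

open FourierTransform in
lemma pairing_cont {d : ℕ} (Ψ : SchwartzMap (EE d) ℂ) (hM : Integrable (MM (Ψ : EE d → ℂ)))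
    (hFc : Continuous (𝓕 (MM (Ψ : EE d → ℂ))))
    (g : ℂ → ℂ) (hg : Continuous g) (hc : HasCompactSupport g) :
    ∫ x, g (qq x) * Ψ x = ∫ ξ, g ξ * 𝓕 (MM (Ψ : EE d → ℂ)) ξ := by
  have hqc := qq_continuous (d := d)
  have hΨc := Ψ.continuous
  set F := 𝓕 (MM (Ψ : EE d → ℂ)) with hF
  have intF : ∀ h : ℂ → ℂ, Continuous h → HasCompactSupport h → Integrable (fun ξ => h ξ * F ξ) := by
    intro h hh hhc
    exact (hh.mul hFc).integrable_of_hasCompactSupport hhc.mul_right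
  have intP : ∀ h : ℂ → ℂ, Continuous h → HasCompactSupport h → Integrable (fun x => h (qq x) * Ψ x) := by
    intro h hh hhc
    obtain ⟨C, hC⟩ := hhc.exists_bound_of_continuous hh
    exact Ψ.integrable.bdd_mul (hh.comp hqc).aestronglyMeasurable (Eventually.of_forall fun x => hC _)
  set A := ∫ x, ‖Ψ x‖
  set B := ∫ ξ in tsupport g, ‖F ξ‖
  have hA : 0 ≤ A := by positivity
  have hB : 0 ≤ B := by positivity
  have key : ∀ ε : ℝ, 0 < ε → ‖(∫ x, g (qq x) * Ψ x) - ∫ ξ, g ξ * F ξ‖ ≤ ε * (A + B) := by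
    intro ε hε
    obtain ⟨g', h1, h2, h3⟩ := hg.exists_contDiff_approx (⊤ : ℕ∞) (ε := fun _ => ε) (by fun_prop) (by intro; positivity)
    have hc' : HasCompactSupport g' := hc.mono h3
    have hp := pairing_smooth Ψ hM g' h1 hc'
    have d1 : ‖(∫ x, g (qq x) * Ψ x) - ∫ x, g' (qq x) * Ψ x‖ ≤ ε * A := by
      rw [← integral_sub (intP g hg hc) (intP g' h1.continuous hc'), ← integral_const_mul]
      refine norm_integral_le_of_norm_le (Ψ.integrable.norm.const_mul ε) (Eventually.of_forall fun x => ?_)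
      rw [← sub_mul, norm_mul]
      gcongr
      rw [← dist_eq_norm, dist_comm]
      exact (h2 _).le
    have d2 : ‖(∫ ξ, g' ξ * F ξ) - ∫ ξ, g ξ * F ξ‖ ≤ ε * B := by
      rw [← integral_sub (intF g' h1.continuous hc') (intF g hg hc), ← integral_const_mul]
      have hs : ∫ ξ, (g' ξ * F ξ - g ξ * F ξ) = ∫ ξ in tsupport g, (g' ξ * F ξ - g ξ * F ξ) := by
        rw [setIntegral_eq_integral_of_forall_compl_eq_zero]
        intro ξ hξ
        have z1 : g ξ = 0 := image_eq_zero_of_notMem_tsupport hξ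
        have z2 : g' ξ = 0 := by
          by_contra hne
          exact (h3 hne) z1
        rw [z1, z2]; ring
      rw [hs]
      refine norm_integral_le_of_norm_le ?_ (Eventually.of_forall fun x => ?_)
      · exact ((hFc.norm.continuousOn.integrableOn_compact hc).integrable).const_mul ε
      rw [← sub_mul, norm_mul]
      gcongr
      rw [← dist_eq_norm]
      exact (h2 _).le
    have : (∫ x, g (qq x) * Ψ x) - ∫ ξ, g ξ * F ξ = ((∫ x, g (qq x) * Ψ x) - ∫ x, g' (qq x) * Ψ x)
        + ((∫ ξ, g' ξ * F ξ) - ∫ ξ, g ξ * F ξ) := by rw [hp]; ring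
    rw [this]
    refine (norm_add_le _ _).trans ?_
    linarith
  have h0 : ‖(∫ x, g (qq x) * Ψ x) - ∫ ξ, g ξ * F ξ‖ ≤ 0 := by
    refine le_of_forall_pos_le_add fun δ hδ => ?_
    refine (key (δ / (A + B + 1)) (by positivity)).trans ?_
    rw [zero_add, div_mul_eq_mul_div, div_le_iff₀ (by positivity)]
    nlinarith
  exact sub_eq_zero.mp (norm_le_zero_iff.mp h0)

lemma padC_add {d : ℕ} (x y : Fin d → ℂ) (n : ℕ) : padC (x + y) n = padC x n + padC y n := by
  unfold padC; split_ifs <;> simp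

lemma padC_smul {d : ℕ} (c : ℂ) (x : Fin d → ℂ) (n : ℕ) : padC (c • x) n = c * padC x n := by
  unfold padC; split_ifs <;> simp

lemma padC_val {d : ℕ} (x : Fin d → ℂ) (i : Fin d) : padC x i.val = x i := by
  unfold padC; simp

/-- the linear change of variables taking the sum of squares to the split form -/
def chg (d : ℕ) : (Fin d → ℂ) →ₗ[ℂ] (Fin d → ℂ) where
  toFun x := fun i => if i.val = 0 then x i else
    if Odd i.val then x i + Complex.I * padC x (i.val + 1) else padC x (i.val - 1) - Complex.I * x i
  map_add' x y := by
    ext i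
    simp only [padC_add, Pi.add_apply]
    split_ifs <;> ring
  map_smul' c x := by
    ext i
    simp only [padC_smul, Pi.smul_apply, smul_eq_mul, RingHom.id_apply]
    split_ifs <;> ring

lemma chg_pad {d : ℕ} (hdo : Odd d) (x : Fin d → ℂ) : padC (chg d x) 0 = padC x 0 ∧
    ∀ i < d / 2, padC (chg d x) (2 * i + 1) = padC x (2 * i + 1) + Complex.I * padC x (2 * i + 2) ∧
      padC (chg d x) (2 * i + 2) = padC x (2 * i + 1) - Complex.I * padC x (2 * i + 2) := by
  obtain ⟨k, hk⟩ := hdo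
  refine ⟨?_, fun i hi => ⟨?_, ?_⟩⟩
  · simp [padC, chg]
  · have h1 : 2 * i + 1 < d := by omega
    have h2 : 2 * i + 2 < d := by omega
    have h3 : Odd (2 * i + 1) := ⟨i, rfl⟩
    simp [padC, chg, h1, h2]
  · have h1 : 2 * i + 1 < d := by omega
    have h2 : 2 * i + 2 < d := by omega
    have h3 : ¬ Odd (2 * i + 2) := by rw [Nat.not_odd_iff_even]; exact ⟨i + 1, by ring⟩
    simp [padC, chg, h1, h2, h3]

lemma sum_odd_pairs (F : ℕ → ℂ) (k : ℕ) : ∑ i ∈ Finset.range (2 * k + 1), F i =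
    F 0 + ∑ i ∈ Finset.range k, (F (2 * i + 1) + F (2 * i + 2)) := by
  induction k with
  | zero => simp
  | succ k ih =>
    rw [show 2 * (k + 1) + 1 = (2 * k + 1) + 1 + 1 by ring, Finset.sum_range_succ, Finset.sum_range_succ, ih,
      Finset.sum_range_succ]
    ring

lemma splitQC_chg {d : ℕ} (hdo : Odd d) (x : Fin d → ℂ) : splitQC d (chg d x) = ∑ j, x j ^ 2 := by
  obtain ⟨h0, h1⟩ := chg_pad hdo x
  have e : ∑ j, x j ^ 2 = ∑ i ∈ Finset.range d, padC x i ^ 2 := by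
    rw [Finset.sum_range]
    refine Finset.sum_congr rfl fun i _ => ?_
    rw [padC_val]
  have hd2 : d = 2 * (d / 2) + 1 := by obtain ⟨k, hk⟩ := hdo; omega
  rw [e, splitQC, if_neg (Nat.not_even_iff_odd.mpr hdo)]
  have hs := sum_odd_pairs (fun i => padC x i ^ 2) (d / 2)
  rw [← hd2] at hs
  rw [hs, h0]
  congr 1
  refine Finset.sum_congr rfl fun i hi => ?_
  obtain ⟨a, b⟩ := h1 i (Finset.mem_range.mp hi)
  rw [a, b]
  linear_combination (-(padC x (2 * i + 2)) ^ 2) * Complex.I_sq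

lemma chg_inj {d : ℕ} (hdo : Odd d) : Function.Injective (chg d) := by
  rw [← LinearMap.ker_eq_bot, LinearMap.ker_eq_bot']
  intro x hx
  obtain ⟨h0, h1⟩ := chg_pad hdo x
  obtain ⟨k, hk⟩ := hdo
  rw [hx] at h0 h1
  have hz : ∀ n, padC (0 : Fin d → ℂ) n = 0 := fun n => by unfold padC; split_ifs <;> simp
  simp only [hz] at h0 h1
  have hp : ∀ i < d / 2, padC x (2 * i + 1) = 0 ∧ padC x (2 * i + 2) = 0 := by
    intro i hi
    obtain ⟨a, b⟩ := h1 i hi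
    have c1 : padC x (2 * i + 1) = 0 := by linear_combination -(1 / 2 : ℂ) * a - (1 / 2 : ℂ) * b
    refine ⟨c1, ?_⟩
    rw [c1, zero_add] at a
    simpa [Complex.I_ne_zero] using a.symm
  ext i
  rw [← padC_val x i, Pi.zero_apply]
  rcases Nat.even_or_odd' i.val with ⟨m, hm | hm⟩
  · rcases Nat.eq_zero_or_pos m with h | h
    · rw [hm, h]; exact h0.symm
    · have := (hp (m - 1) (by omega)).2
      rwa [show 2 * (m - 1) + 2 = i.val by omega] at this
  · rw [hm]
    exact (hp m (by omega)).1

lemma exists_chg {d : ℕ} (hdo : Odd d) : ∃ T : EE d ≃L[ℝ] (Fin d → ℂ), ∀ x, splitQC d (T x) = qq x := by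
  let e1 : (Fin d → ℂ) ≃ₗ[ℂ] (Fin d → ℂ) := LinearEquiv.ofInjectiveEndo (chg d) (chg_inj hdo)
  let e2 : (Fin d → ℂ) ≃L[ℝ] (Fin d → ℂ) := (e1.restrictScalars ℝ).toContinuousLinearEquiv
  refine ⟨(PiLp.continuousLinearEquiv 2 ℝ (fun _ : Fin d => ℂ)).trans e2, fun x => ?_⟩
  exact splitQC_chg hdo (fun j => x j)

open FourierTransform in
lemma germ_exists (d : ℕ) (hd : 3 ≤ d) (hdo : Odd d) (Φ : SchwartzMap (Fin d → ℂ) ℂ) :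
    ∃ f : ℂ → ℂ,
      (∀ n : ℕ, ContDiffOn ℝ n f ({0}ᶜ : Set ℂ)) ∧
      (∀ g : ℂ → ℂ, Continuous g → HasCompactSupport g → (0 : ℂ) ∉ tsupport g →
        ∫ z : Fin d → ℂ, g (splitQC d z) * Φ z = ∫ ξ : ℂ, g ξ * f ξ) ∧
      (∃ C₀ C₁ : ℂ → ℂ,
        (∀ n : ℕ, ContDiff ℝ n C₀) ∧ (∀ n : ℕ, ContDiff ℝ n C₁) ∧
        ∀ ξ : ℂ, ξ ≠ 0 →
          f ξ = C₀ ξ + C₁ ξ * ((‖ξ‖ ^ (d - 2) : ℝ) : ℂ)) := by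
  obtain ⟨T, hT⟩ := exists_chg hdo
  obtain ⟨c, hc⟩ := haar_transport T
  let Ψ : SchwartzMap (EE d) ℂ := (c : ℂ) • SchwartzMap.compCLMOfContinuousLinearEquiv ℂ T Φ
  have hΨ : ∀ x, Ψ x = (c : ℂ) * Φ (T x) := fun x => rfl
  have hΨF : 𝓕 ((𝓕⁻ Ψ : SchwartzMap (EE d) ℂ) : EE d → ℂ) = Ψ := by
    rw [← SchwartzMap.fourier_coe]
    simp
  obtain ⟨p, hp⟩ := MM_asymp (𝓕⁻ Ψ : SchwartzMap (EE d) ℂ)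
  rw [hΨF] at hp
  obtain ⟨k, hk⟩ := hdo
  obtain ⟨e, rfl⟩ : ∃ e, d = 2 * e + 3 := ⟨k - 1, by omega⟩
  obtain ⟨hM, C₀, C₁, h0, h1, hF⟩ := fourier_germ e (MM (Ψ : EE (2 * e + 3) → ℂ)) (MM_continuous Ψ) p hp
  have hd2 : 2 * e + 3 - 2 = 2 * e + 1 := by omega
  have hFeq : 𝓕 (MM (Ψ : EE (2 * e + 3) → ℂ)) = fun ξ => C₀ ξ + C₁ ξ * ((‖ξ‖ ^ (2 * e + 1) : ℝ) : ℂ) :=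
    funext hF
  refine ⟨𝓕 (MM (Ψ : EE (2 * e + 3) → ℂ)), fun n => ?_, fun g hg hgc _ => ?_, C₀, C₁, h0, h1, fun ξ _ => ?_⟩
  · rw [hFeq]
    intro ξ hξ
    have hn : ContDiffAt ℝ n (fun x : ℂ => ‖x‖) ξ := contDiffAt_norm ℝ hξ
    have h2 : ContDiffAt ℝ n (fun x : ℂ => ((‖x‖ ^ (2 * e + 1) : ℝ) : ℂ)) ξ :=
      Complex.ofRealCLM.contDiff.contDiffAt.comp ξ (hn.pow _)
    exact ((h0 n).contDiffAt.add ((h1 n).contDiffAt.mul h2)).contDiffWithinAt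
  · have hcF : Continuous (𝓕 (MM (Ψ : EE (2 * e + 3) → ℂ))) := by
      rw [hFeq]
      have a0 := (h0 0).continuous
      have a1 := (h1 0).continuous
      fun_prop
    rw [← pairing_cont Ψ hM hcF g hg hgc, hc, ← integral_const_mul]
    refine integral_congr_ae (Eventually.of_forall fun x => ?_)
    simp only
    rw [hT, hΨ]
    ring
  · rw [hF, hd2]

lemma germ_unique (f f' : ℂ → ℂ) (hf : ContinuousOn f ({0}ᶜ : Set ℂ)) (hf' : ContinuousOn f' ({0}ᶜ : Set ℂ))
    (h : ∀ g : ℂ → ℂ, Continuous g → HasCompactSupport g → (0 : ℂ) ∉ tsupport g →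
      ∫ ξ : ℂ, g ξ * f' ξ = ∫ ξ : ℂ, g ξ * f ξ) : Set.EqOn f' f ({0}ᶜ : Set ℂ) := by
  have hU : IsOpen ({0}ᶜ : Set ℂ) := isOpen_compl_singleton
  have hInt : ∀ F : ℂ → ℂ, ContinuousOn F ({0}ᶜ : Set ℂ) → ∀ g : ℂ → ℂ, Continuous g → HasCompactSupport g →
      (0 : ℂ) ∉ tsupport g → Integrable (fun ξ => g ξ * F ξ) := by
    intro F hF g hg hgc hg0
    have hsub : tsupport g ⊆ ({0}ᶜ : Set ℂ) := by
      intro x hx hx0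
      rw [Set.mem_singleton_iff] at hx0
      exact hg0 (hx0 ▸ hx)
    have h1 : IntegrableOn (fun ξ => g ξ * F ξ) (tsupport g) :=
      (hg.continuousOn.mul (hF.mono hsub)).integrableOn_compact hgc
    rw [integrableOn_iff_integrable_of_support_subset] at h1
    · exact h1
    · intro x hx
      apply subset_tsupport g
      intro h0
      apply hx
      simp [h0]
  have hae : ∀ᵐ x : ℂ, x ∈ ({0}ᶜ : Set ℂ) → (f' - f) x = 0 := by
    refine hU.ae_eq_zero_of_integral_contDiff_smul_eq_zero
      ((hf'.sub hf).locallyIntegrableOn hU.measurableSet) fun g hg hgc hgs => ?_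
    let G : ℂ → ℂ := fun x => ((g x : ℝ) : ℂ)
    have hG : Continuous G := Complex.continuous_ofReal.comp hg.continuous
    have hGc : HasCompactSupport G := hgc.comp_left (g := fun r : ℝ => (r : ℂ)) (by simp)
    have hGs : (0 : ℂ) ∉ tsupport G := by
      intro h0
      have : tsupport G ⊆ tsupport g := closure_mono fun x hx hx0 => hx (by
        change ((g x : ℝ) : ℂ) = 0
        rw [hx0]; simp)
      exact hgs (this h0) rfl
    have hh := h G hG hGc hGs
    rw [← sub_eq_zero, ← integral_sub (hInt f' hf' G hG hGc hGs) (hInt f hf G hG hGc hGs)] at hh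
    rw [← hh]
    refine integral_congr_ae (Eventually.of_forall fun x => ?_)
    simp only [Pi.sub_apply, Complex.real_smul, G]
    ring
  refine Measure.eqOn_open_of_ae_eq (μ := volume) ?_ hU hf' hf
  rw [Filter.EventuallyEq, ae_restrict_iff' hU.measurableSet]
  filter_upwards [hae] with x hx hx0
  exact sub_eq_zero.mp (hx hx0)

/-- germ of the pushforward of a Schwartz measure under the split quadratic
form on `ℂ^d`, `d` odd: there is a unique density `f`, smooth (as a function of the two
real coordinates) away from `0`, and at `0` it has the form `C₀(ξ) + C₁(ξ)·|ξ|^{d−2}`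
with `C₀, C₁` smooth (no logarithm). -/
theorem germ_pushforward_complex_odd (d : ℕ) (hd : 3 ≤ d) (hdo : Odd d)
    (Φ : SchwartzMap (Fin d → ℂ) ℂ) :
    ∃ f : ℂ → ℂ,
      (∀ n : ℕ, ContDiffOn ℝ n f ({0}ᶜ : Set ℂ)) ∧
      (∀ g : ℂ → ℂ, Continuous g → HasCompactSupport g → (0 : ℂ) ∉ tsupport g →
        ∫ z : Fin d → ℂ, g (splitQC d z) * Φ z = ∫ ξ : ℂ, g ξ * f ξ) ∧
      (∀ f' : ℂ → ℂ, (∀ n : ℕ, ContDiffOn ℝ n f' ({0}ᶜ : Set ℂ)) →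
        (∀ g : ℂ → ℂ, Continuous g → HasCompactSupport g → (0 : ℂ) ∉ tsupport g →
          ∫ z : Fin d → ℂ, g (splitQC d z) * Φ z = ∫ ξ : ℂ, g ξ * f' ξ) →
        Set.EqOn f' f ({0}ᶜ : Set ℂ)) ∧
      (∃ C₀ C₁ : ℂ → ℂ,
        (∀ n : ℕ, ContDiff ℝ n C₀) ∧ (∀ n : ℕ, ContDiff ℝ n C₁) ∧
        ∀ ξ : ℂ, ξ ≠ 0 →
          f ξ = C₀ ξ + C₁ ξ * ((‖ξ‖ ^ (d - 2) : ℝ) : ℂ)) := by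
  obtain ⟨f, hfs, hfp, hC⟩ := germ_exists d hd hdo Φ
  refine ⟨f, hfs, hfp, fun f' hf' hp' => ?_, hC⟩
  exact germ_unique f f' (hfs 0).continuousOn (hf' 0).continuousOn
    (fun g h1 h2 h3 => (hp' g h1 h2 h3).symm.trans (hfp g h1 h2 h3))
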